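/- arXiv:2512.09624 — 3 statements merged into one kernel-verified Lean document; each statement's English description precedes it below -/
import Mathlib

section
/- Let f be a C¹ local diffeomorphism of the 2-torus 𝕋² of degree d > 1. The following three conditions are equivalent: (1) liminf_{n→∞} (1/n) inf_{(x,v)∈T¹𝕋²} I(x,v;fⁿ) > 0; (2) there exist N∈ℕ and C > 0 such that I(x,v;f^N) > C for every (x,v)∈T¹𝕋²; (3) there exists C > 0 such that I_f(x) > C for every x∈𝕋². -/
open MeasureTheory Filter Topology Set
open scoped ENNReal NNReal

noncomputable section


open MeasureTheory Filter Topology Set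
open scoped ENNReal NNReal

noncomputable section

instance fact_zero_lt_one' : Fact ((0:ℝ) < 1) := ⟨one_pos⟩

/-- The plane `ℝ²` with the Euclidean norm: the universal cover of the 2-torus and the
common model of all its tangent spaces. -/
abbrev V2 : Type := EuclideanSpace ℝ (Fin 2)

/-- The flat 2-torus `𝕋² = ℝ²/ℤ²`. -/
abbrev T2 : Type := AddCircle (1 : ℝ) × AddCircle (1 : ℝ)

/-- The covering projection `ℝ² → 𝕋²`. -/
def proj (p : V2) : T2 := (↑(p 0), ↑(p 1))

/-- The integer vector `(m 0, m 1)` as an element of the plane. -/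
def iv (m : Fin 2 → ℤ) : V2 := (WithLp.equiv 2 (Fin 2 → ℝ)).symm (fun i => (m i : ℝ))

/-- A `C^r` local diffeomorphism of the 2-torus, encoded by a `C^r` lift `F : ℝ² → ℝ²`
equivariant with respect to an integer linear part `A`, together with the induced map
`toFun` on the torus and its derivative cocycle `D` (tangent spaces being canonically `ℝ²`);
invertibility of `D` at every point expresses that the map is a local diffeomorphism. -/
structure TorusMap (r : ℕ) : Type where
  F : V2 → V2
  contDiff : ContDiff ℝ r F
  A : Matrix (Fin 2) (Fin 2) ℤ
  equivar : ∀ (p : V2) (m : Fin 2 → ℤ), F (p + iv m) = F p + iv (A.mulVec m)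
  toFun : T2 → T2
  toFun_proj : ∀ p : V2, toFun (proj p) = proj (F p)
  D : T2 → (V2 →L[ℝ] V2)
  D_proj : ∀ p : V2, D (proj p) = fderiv ℝ F p
  isUnit_D : ∀ x : T2, IsUnit (D x)

namespace TorusMap

variable {r : ℕ}

/-- The degree of `f`: the number of preimages of any point, `|det A|`. -/
def deg (f : TorusMap r) : ℕ := f.A.det.natAbs

/-- The derivative of `f^[n]` at `x` (by the chain rule). -/
def Dn (f : TorusMap r) : ℕ → T2 → (V2 →L[ℝ] V2)
  | 0, _ => ContinuousLinearMap.id ℝ V2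
  | n + 1, x => (Dn f n (f.toFun x)).comp (f.D x)

/-- The inverse `(Df^n_x)⁻¹` of the derivative of `f^[n]` at `x`. -/
def Dninv (f : TorusMap r) (n : ℕ) (x : T2) : V2 →L[ℝ] V2 := Ring.inverse (f.Dn n x)

/-- `I(x,v;fⁿ) = d^{-n} ∑_{y ∈ f^{-n}(x)} log ‖(Dfⁿ_y)⁻¹ · v‖`. -/
def I (f : TorusMap r) (x : T2) (v : V2) (n : ℕ) : ℝ :=
  ((f.deg : ℝ) ^ n)⁻¹ * ∑ᶠ y ∈ (f.toFun^[n]) ⁻¹' {x}, Real.log ‖f.Dninv n y v‖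

/-- `inf_{(x,v) ∈ T¹𝕋²} I(x,v;fⁿ)`. -/
def unifInf (f : TorusMap r) (n : ℕ) : ℝ :=
  ⨅ xv : T2 × Metric.sphere (0 : V2) 1, f.I xv.1 (xv.2 : V2) n

/-- `C(f) = liminf_{n→∞} (1/n) inf_{(x,v) ∈ T¹𝕋²} I(x,v;fⁿ)`. -/
def C (f : TorusMap r) : ℝ := Filter.liminf (fun n : ℕ => f.unifInf n / n) Filter.atTop

/-- `I_f(x) = limsup_{n→∞} (1/n) inf_{v ∈ T¹_x𝕋²} I(x,v;fⁿ)`. -/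
def Isup (f : TorusMap r) (x : T2) : ℝ :=
  Filter.limsup (fun n : ℕ => (⨅ v : Metric.sphere (0 : V2) 1, f.I x (v : V2) n) / n)
    Filter.atTop

/-- The determinant of the derivative of `f` at `x`. -/
def detD (f : TorusMap r) (x : T2) : ℝ := LinearMap.det (f.D x : V2 →ₗ[ℝ] V2)

/-- `μ` is an `f`-invariant measure. -/
def Invariant (f : TorusMap r) (μ : Measure T2) : Prop :=
  ∀ s : Set T2, MeasurableSet s → μ (f.toFun ⁻¹' s) = μ s

/-- `μ` is equidistributed: `μ(f(A)) = d·μ(A)` for every Borel set `A` on which `f` is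
injective (equivalently, `μ` maximizes the folding entropy: `F_μ(f) = log d`). -/
def Equidistributed (f : TorusMap r) (μ : Measure T2) : Prop :=
  ∀ s : Set T2, MeasurableSet s → Set.InjOn f.toFun s →
    μ (f.toFun '' s) = (f.deg : ℝ≥0∞) * μ s

end TorusMap

/-- The minimal norm (conorm) of a linear map of the plane. -/
def minNorm (L : V2 →L[ℝ] V2) : ℝ := ⨅ v : Metric.sphere (0 : V2) 1, ‖L (v : V2)‖


lemma iv_apply (m : Fin 2 → ℤ) (i : Fin 2) : iv m i = (m i : ℝ) := rfl

lemma iv_add (m k : Fin 2 → ℤ) : iv (m + k) = iv m + iv k := by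
  ext i; simp [iv_apply]

lemma iv_neg (m : Fin 2 → ℤ) : iv (-m) = - iv m := by
  ext i; simp [iv_apply]

lemma iv_sub (m k : Fin 2 → ℤ) : iv (m - k) = iv m - iv k := by
  ext i; simp [iv_apply]

lemma iv_inj {m k : Fin 2 → ℤ} (h : iv m = iv k) : m = k := by
  funext i
  have := congrArg (fun v : V2 => v i) h
  simpa [iv_apply] using this

lemma coe_eq_coe_iff' (a b : ℝ) : ((a : AddCircle (1:ℝ)) = b) ↔ ∃ n : ℤ, a = b + n := by
  rw [← sub_eq_zero, ← AddCircle.coe_sub, AddCircle.coe_eq_zero_iff]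
  constructor
  · rintro ⟨n, hn⟩; exact ⟨n, by simp at hn; linarith⟩
  · rintro ⟨n, hn⟩; exact ⟨n, by simp; linarith⟩

lemma proj_eq_iff (p q : V2) : proj p = proj q ↔ ∃ m : Fin 2 → ℤ, p = q + iv m := by
  unfold proj
  rw [Prod.mk.injEq, coe_eq_coe_iff', coe_eq_coe_iff']
  constructor
  · rintro ⟨⟨a, ha⟩, ⟨b, hb⟩⟩
    refine ⟨![a, b], ?_⟩
    ext i
    fin_cases i
    · simpa [iv_apply] using ha
    · simpa [iv_apply] using hb
  · rintro ⟨m, hm⟩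
    exact ⟨⟨m 0, by rw [hm]; rfl⟩, ⟨m 1, by rw [hm]; rfl⟩⟩

lemma proj_add_iv (p : V2) (m : Fin 2 → ℤ) : proj (p + iv m) = proj p :=
  (proj_eq_iff _ _).2 ⟨m, rfl⟩

lemma exists_bdd_rep (p : V2) : ∃ p0 : V2, ∃ m : Fin 2 → ℤ, ‖p0‖ ≤ 2 ∧ p = p0 + iv m := by
  refine ⟨p - iv (fun i => ⌊p i⌋), fun i => ⌊p i⌋, ?_, by simp⟩
  rw [EuclideanSpace.norm_eq, Fin.sum_univ_two, Real.sqrt_le_left (by norm_num)]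
  have h (i : Fin 2) : ‖(p - iv (fun i => ⌊p i⌋)) i‖ ^ 2 ≤ 1 := by
    have : (p - iv (fun i => ⌊p i⌋)) i = Int.fract (p i) := rfl
    rw [this, Real.norm_eq_abs, sq_abs]
    nlinarith [Int.fract_nonneg (p i), Int.fract_lt_one (p i)]
  linarith [h 0, h 1]

lemma proj_surj' (x : T2) : ∃ p : V2, proj p = x := by
  obtain ⟨a, b⟩ := x
  induction a using QuotientAddGroup.induction_on with | H a => ?_
  induction b using QuotientAddGroup.induction_on with | H b => ?_
  exact ⟨!₂[a, b], rfl⟩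

lemma proj_surj (x : T2) : ∃ p : V2, ‖p‖ ≤ 2 ∧ proj p = x := by
  obtain ⟨p, rfl⟩ := proj_surj' x
  obtain ⟨p0, m, h, rfl⟩ := exists_bdd_rep p
  exact ⟨p0, h, (proj_add_iv _ _).symm⟩

lemma iv_mulVec_bound (M : Matrix (Fin 2) (Fin 2) ℤ) :
    ∃ c : ℝ, 0 ≤ c ∧ ∀ k, ‖iv (M.mulVec k)‖ ≤ c * ‖iv k‖ := by
  let L : V2 →L[ℝ] V2 := LinearMap.toContinuousLinearMap
    (Matrix.toEuclideanLin (M.map (fun z : ℤ => (z : ℝ))))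
  refine ⟨‖L‖, norm_nonneg _, fun k => ?_⟩
  have : iv (M.mulVec k) = L (iv k) := by
    ext i
    fin_cases i <;> simp [L, iv, Matrix.toLpLin_apply, Matrix.mulVec, dotProduct]
  rw [this]
  exact L.le_opNorm _

namespace TorusMap

lemma det_ne (f : TorusMap 1) (hdeg : 1 < f.deg) : f.A.det ≠ 0 := by
  intro h
  simp [deg, h] at hdeg

lemma F_cont (f : TorusMap 1) : Continuous f.F := f.contDiff.continuous

lemma F_growth (f : TorusMap 1) (hdeg : 1 < f.deg) :
    ∃ a b : ℝ, 0 ≤ a ∧ ∀ p, ‖p‖ ≤ a * ‖f.F p‖ + b := by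
  obtain ⟨c, hc, hcb⟩ := iv_mulVec_bound f.A.adjugate
  obtain ⟨B, hB⟩ := (isCompact_closedBall (0 : V2) 2).exists_bound_of_continuousOn
    f.F_cont.continuousOn
  refine ⟨c, c * B + 2, hc, fun p => ?_⟩
  obtain ⟨p0, m, h0, rfl⟩ := exists_bdd_rep p
  have h1 := hcb (f.A.mulVec m)
  have h2 : iv (f.A.adjugate.mulVec (f.A.mulVec m)) = (f.A.det : ℝ) • iv m := by
    rw [Matrix.mulVec_mulVec, Matrix.adjugate_mul]
    ext i
    simp [iv_apply]
  rw [h2, norm_smul] at h1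
  have h3 : (1:ℝ) ≤ ‖(f.A.det : ℝ)‖ := by
    have := Int.one_le_abs (f.det_ne hdeg)
    rw [Real.norm_eq_abs]
    exact_mod_cast this
  have h4 := f.equivar p0 m
  have h5 : ‖iv (f.A.mulVec m)‖ ≤ ‖f.F (p0 + iv m)‖ + B := by
    have : iv (f.A.mulVec m) = f.F (p0 + iv m) - f.F p0 := by rw [h4]; simp
    rw [this]
    refine (norm_sub_le _ _).trans ?_
    have := hB p0 (by simpa using h0)
    linarith
  have h6 := norm_add_le p0 (iv m)
  have h7 : ‖iv m‖ ≤ ‖(f.A.det : ℝ)‖ * ‖iv m‖ := le_mul_of_one_le_left (norm_nonneg _) h3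
  have h8 := mul_le_mul_of_nonneg_left h5 hc
  linarith

lemma F_proper (f : TorusMap 1) (hdeg : 1 < f.deg) : IsProperMap f.F := by
  rw [isProperMap_iff_tendsto_cocompact]
  refine ⟨f.F_cont, ?_⟩
  obtain ⟨a, b, ha, h⟩ := f.F_growth hdeg
  rw [← Metric.cobounded_eq_cocompact, ← tendsto_norm_atTop_iff_cobounded]
  have h1 : Tendsto (fun p : V2 => ‖p‖) (Bornology.cobounded V2) atTop := tendsto_norm_cobounded_atTop
  rw [tendsto_atTop] at h1 ⊢
  intro R
  filter_upwards [h1 (a * R + b + 1)] with p hp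
  have := h p
  by_contra! hlt
  have := mul_le_mul_of_nonneg_left hlt.le ha
  linarith

lemma F_localHomeo (f : TorusMap 1) : IsLocalHomeomorph f.F := by
  intro p
  have hu := f.isUnit_D (proj p)
  rw [f.D_proj p] at hu
  obtain ⟨u, hu⟩ := hu
  have hd : HasFDerivAt f.F ((ContinuousLinearEquiv.unitsEquiv ℝ V2 u : V2 ≃L[ℝ] V2) : V2 →L[ℝ] V2) p := by
    have h1 := (f.contDiff.differentiable (by norm_num) p).hasFDerivAt
    rw [← hu] at h1
    exact h1
  refine ⟨(f.contDiff.contDiffAt (x := p)).toOpenPartialHomeomorph f.F hd (by norm_num), ?_, ?_⟩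
  · exact ContDiffAt.mem_toOpenPartialHomeomorph_source _ hd _
  · exact (ContDiffAt.toOpenPartialHomeomorph_coe _ hd _).symm

lemma F_covering (f : TorusMap 1) (hdeg : 1 < f.deg) : IsCoveringMap f.F := by
  rw [isCoveringMap_iff_isCoveringMapOn_univ]
  refine (f.F_proper hdeg).isClosedMap.isCoveringMapOn_of_isLocalHomeomorphOn ?_ ?_
  · intro x _
    have hc := (f.F_proper hdeg).isCompact_preimage (isCompact_singleton (x := x))
    refine hc.finite ?_
    refine IsDiscrete.of_openPartialHomeomorph (x := x) f.F subset_rfl ?_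
    intro e _
    obtain ⟨φ, h, h'⟩ := f.F_localHomeo e
    exact ⟨φ, h, h'.symm⟩
  · exact f.F_localHomeo.isLocalHomeomorphOn.mono (subset_univ _)

lemma exists_inverse (f : TorusMap 1) (hdeg : 1 < f.deg) :
    ∃ G : V2 → V2, Continuous G ∧ (∀ q, f.F (G q) = q) ∧ (∀ p, G (f.F p) = p) := by
  have cov := f.F_covering hdeg
  obtain ⟨G, ⟨hG0, hG⟩, -⟩ := cov.existsUnique_continuousMap_lifts
    (ContinuousMap.id V2) (f.F 0) 0 rfl
  have h1 : ∀ q, f.F (G q) = q := fun q => congrFun hG q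
  refine ⟨G, G.continuous, h1, ?_⟩
  have := cov.eq_of_comp_eq (g₁ := G ∘ f.F) (g₂ := id) (G.continuous.comp f.F_cont)
    continuous_id (by funext p; simp [h1]) 0 (by simpa using hG0)
  exact fun p => congrFun this p

lemma card_quot (f : TorusMap 1) (hdeg : 1 < f.deg) :
    Nat.card ((Fin 2 → ℤ) ⧸ LinearMap.range (Matrix.toLin' f.A)) = f.deg := by
  have hinj : Function.Injective (Matrix.toLin' f.A) := by
    rw [← LinearMap.ker_eq_bot, LinearMap.ker_eq_bot']
    intro m hm
    exact Matrix.eq_zero_of_mulVec_eq_zero (f.det_ne hdeg) (by simpa using hm)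
  have := Submodule.natAbs_det_equiv (LinearMap.range (Matrix.toLin' f.A))
    (LinearEquiv.ofInjective _ hinj)
  rw [← this, deg, ← LinearMap.det_toLin' f.A]
  rfl

/-- Parametrization of the fibres of `f` by a fixed finite set of continuous branches. -/
lemma exists_branches (f : TorusMap 1) (hdeg : 1 < f.deg) :
    ∃ g : Fin f.deg → V2 → V2, (∀ j, Continuous (g j)) ∧
      (∀ q, Function.Injective (fun j => proj (g j q))) ∧
      (∀ q, Set.range (fun j => proj (g j q)) = f.toFun ⁻¹' {proj q}) := by
  obtain ⟨G, hGc, hFG, hGF⟩ := f.exists_inverse hdeg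
  have hcard := f.card_quot hdeg
  have hfin : Finite ((Fin 2 → ℤ) ⧸ LinearMap.range (Matrix.toLin' f.A)) :=
    Nat.finite_of_card_ne_zero (by omega)
  let e := (Finite.equivFinOfCardEq hcard).symm
  refine ⟨fun j q => G (q + iv (e j).out), fun j => by fun_prop, ?_, ?_⟩
  · intro q i j hij
    obtain ⟨k, hk⟩ := (proj_eq_iff _ _).1 hij
    have h1 := congrArg f.F hk
    rw [f.equivar, hFG, hFG, add_assoc, add_right_inj, ← iv_add] at h1
    have h2 := iv_inj h1
    apply e.injective
    rw [← Quotient.out_eq (e i), ← Quotient.out_eq (e j)]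
    refine (Submodule.Quotient.eq _).2 ?_
    refine ⟨k, ?_⟩
    rw [h2]; simp
  · intro q
    ext y
    constructor
    · rintro ⟨j, rfl⟩
      simp only [mem_preimage, f.toFun_proj, hFG, proj_add_iv, mem_singleton_iff]
    · intro hy
      obtain ⟨p, rfl⟩ := proj_surj' y
      simp only [mem_preimage, f.toFun_proj, mem_singleton_iff] at hy
      obtain ⟨m, hm⟩ := (proj_eq_iff _ _).1 hy
      obtain ⟨j, hj⟩ := e.surjective (Submodule.Quotient.mk m)
      have h1 : (Submodule.Quotient.mk (e j).out :
          (Fin 2 → ℤ) ⧸ LinearMap.range (Matrix.toLin' f.A)) = Submodule.Quotient.mk m := by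
        rw [← hj]; exact Quotient.out_eq (e j)
      obtain ⟨k, hk⟩ := (Submodule.Quotient.eq _).1 h1
      refine ⟨j, ?_⟩
      have h2 : (e j).out = m + f.A.mulVec k := by
        rw [Matrix.toLin'_apply] at hk
        rw [hk]; abel
      have h3 : q + iv (e j).out = f.F (p + iv k) := by
        rw [f.equivar, hm, h2, iv_add, add_assoc]
      simp only [h3, hGF, proj_add_iv]

end TorusMap

namespace TorusMap

/-- The inverse of the derivative at a point. -/
def Dinv (f : TorusMap 1) (y : T2) : V2 →L[ℝ] V2 := Ring.inverse (f.D y)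

lemma D_Dinv (f : TorusMap 1) (y : T2) (v : V2) : f.D y (f.Dinv y v) = v := by
  have := Ring.mul_inverse_cancel _ (f.isUnit_D y)
  exact congrArg (fun L : V2 →L[ℝ] V2 => L v) this

lemma Dinv_ne (f : TorusMap 1) (y : T2) {v : V2} (hv : v ≠ 0) : f.Dinv y v ≠ 0 := by
  intro h
  apply hv
  rw [← f.D_Dinv y v, h, map_zero]

lemma isUnit_Dn (f : TorusMap 1) (n : ℕ) (x : T2) : IsUnit (f.Dn n x) := by
  induction n generalizing x with
  | zero => exact isUnit_one
  | succ n ih => exact (ih (f.toFun x)).mul (f.isUnit_D x)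

lemma Dninv_succ (f : TorusMap 1) (n : ℕ) (z : T2) (v : V2) :
    f.Dninv (n + 1) z v = f.Dinv z (f.Dninv n (f.toFun z) v) := by
  have h : f.Dninv (n + 1) z = f.Dinv z * f.Dninv n (f.toFun z) := by
    unfold Dninv Dinv
    change Ring.inverse (f.Dn n (f.toFun z) * f.D z) = _
    obtain ⟨u, hu⟩ := f.isUnit_Dn n (f.toFun z)
    obtain ⟨w, hw⟩ := f.isUnit_D z
    rw [← hu, ← hw, ← Units.val_mul, Ring.inverse_unit, Ring.inverse_unit, Ring.inverse_unit,
      mul_inv_rev, Units.val_mul]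
  rw [h]; rfl

/-- The averaging operator. -/
def P (f : TorusMap 1) (φ : T2 → V2 → ℝ) (x : T2) (v : V2) : ℝ :=
  (f.deg : ℝ)⁻¹ * ∑ᶠ y ∈ f.toFun ⁻¹' {x}, φ y (f.Dinv y v)

lemma fib_finite (f : TorusMap 1) (hdeg : 1 < f.deg) (x : T2) :
    (f.toFun ⁻¹' {x}).Finite := by
  obtain ⟨g, -, -, hg⟩ := f.exists_branches hdeg
  obtain ⟨q, rfl⟩ := proj_surj' x
  rw [← hg]
  exact Set.finite_range _

lemma preimage_succ (f : TorusMap 1) (n : ℕ) (x : T2) :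
    (f.toFun^[n+1]) ⁻¹' {x} = ⋃ y ∈ (f.toFun^[n]) ⁻¹' {x}, f.toFun ⁻¹' {y} := by
  ext z
  simp

lemma fibn_finite (f : TorusMap 1) (hdeg : 1 < f.deg) (n : ℕ) (x : T2) :
    ((f.toFun^[n]) ⁻¹' {x}).Finite := by
  induction n with
  | zero => simp
  | succ n ih =>
    rw [preimage_succ]
    exact ih.biUnion fun y _ => f.fib_finite hdeg y

lemma P_iter (f : TorusMap 1) (hdeg : 1 < f.deg) (n : ℕ) (φ : T2 → V2 → ℝ) (x : T2) (v : V2) :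
    (f.P^[n] φ) x v = ((f.deg : ℝ) ^ n)⁻¹ *
      ∑ᶠ y ∈ (f.toFun^[n]) ⁻¹' {x}, φ y (f.Dninv n y v) := by
  induction n generalizing φ with
  | zero =>
    have h : ∀ y, f.Dninv 0 y v = v := by
      intro y
      change Ring.inverse (1 : V2 →L[ℝ] V2) v = v
      rw [Ring.inverse_one]; rfl
    simp [h]
  | succ n ih =>
    rw [Function.iterate_succ_apply, ih, preimage_succ, finsum_mem_biUnion, pow_succ, mul_inv,
      mul_assoc]
    · congr 1
      rw [mul_finsum_mem' _ _ (f.fibn_finite hdeg n x)]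
      refine finsum_mem_congr rfl fun y _ => ?_
      unfold P
      congr 1
      refine finsum_mem_congr rfl fun z hz => ?_
      rw [Dninv_succ, show f.toFun z = y from hz]
    · intro a _ b _ hab
      rw [Function.onFun, Set.disjoint_left]
      intro z hz hz'
      exact hab ((show f.toFun z = a from hz).symm.trans hz')
    · exact f.fibn_finite hdeg n x
    · exact fun y _ => f.fib_finite hdeg y

/-- The logarithm of the norm. -/
def ell (_ : T2) (v : V2) : ℝ := Real.log ‖v‖

lemma I_eq (f : TorusMap 1) (hdeg : 1 < f.deg) (n : ℕ) (x : T2) (v : V2) :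
    f.I x v n = (f.P^[n] ell) x v := by
  rw [P_iter f hdeg]; rfl

lemma P_branch (f : TorusMap 1) (g : Fin f.deg → V2 → V2)
      (hi : ∀ q, Function.Injective (fun j => proj (g j q)))
      (hr : ∀ q, Set.range (fun j => proj (g j q)) = f.toFun ⁻¹' {proj q})
      (φ : T2 → V2 → ℝ) (q v : V2) :
    f.P φ (proj q) v =
      (f.deg : ℝ)⁻¹ * ∑ j, φ (proj (g j q)) (f.Dinv (proj (g j q)) v) := by
  unfold P
  rw [← hr, finsum_mem_range (hi q), finsum_eq_sum_of_fintype]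

lemma P_mono (f : TorusMap 1) (hdeg : 1 < f.deg) {φ ψ : T2 → V2 → ℝ}
    (h : ∀ y v, v ≠ 0 → φ y v ≤ ψ y v) (x : T2) (v : V2) (hv : v ≠ 0) :
    f.P φ x v ≤ f.P ψ x v := by
  obtain ⟨g, -, hi, hr⟩ := f.exists_branches hdeg
  obtain ⟨q, rfl⟩ := proj_surj' x
  rw [f.P_branch g hi hr, f.P_branch g hi hr]
  gcongr with j _
  exact h _ _ (f.Dinv_ne _ hv)

lemma P_add_const (f : TorusMap 1) (hdeg : 1 < f.deg) (φ : T2 → V2 → ℝ) (c : ℝ) :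
    f.P (fun y v => φ y v + c) = fun y v => f.P φ y v + c := by
  obtain ⟨g, -, hi, hr⟩ := f.exists_branches hdeg
  funext x v
  obtain ⟨q, rfl⟩ := proj_surj' x
  rw [f.P_branch g hi hr, f.P_branch g hi hr, Finset.sum_add_distrib, mul_add]
  have : (f.deg : ℝ) ≠ 0 := by positivity
  simp [this]

lemma Pn_mono (f : TorusMap 1) (hdeg : 1 < f.deg) (n : ℕ) {φ ψ : T2 → V2 → ℝ}
    (h : ∀ y v, v ≠ 0 → φ y v ≤ ψ y v) (x : T2) (v : V2) (hv : v ≠ 0) :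
    (f.P^[n] φ) x v ≤ (f.P^[n] ψ) x v := by
  induction n generalizing φ ψ with
  | zero => exact h x v hv
  | succ n ih => exact ih (f.P_mono hdeg h)

lemma Pn_add_const (f : TorusMap 1) (hdeg : 1 < f.deg) (n : ℕ) (φ : T2 → V2 → ℝ) (c : ℝ) :
    f.P^[n] (fun y v => φ y v + c) = fun y v => (f.P^[n] φ) y v + c := by
  induction n generalizing φ with
  | zero => rfl
  | succ n ih => rw [Function.iterate_succ_apply, P_add_const f hdeg, ih]; rfl

lemma P_hom (f : TorusMap 1) (hdeg : 1 < f.deg) {φ : T2 → V2 → ℝ}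
    (h : ∀ y v (c : ℝ), 0 < c → v ≠ 0 → φ y (c • v) = φ y v + Real.log c)
    (x : T2) (v : V2) (c : ℝ) (hc : 0 < c) (hv : v ≠ 0) :
    f.P φ x (c • v) = f.P φ x v + Real.log c := by
  obtain ⟨g, -, hi, hr⟩ := f.exists_branches hdeg
  obtain ⟨q, rfl⟩ := proj_surj' x
  have hd : (f.deg : ℝ) ≠ 0 := by positivity
  rw [f.P_branch g hi hr, f.P_branch g hi hr]
  have : ∀ j, φ (proj (g j q)) (f.Dinv (proj (g j q)) (c • v)) =
      φ (proj (g j q)) (f.Dinv (proj (g j q)) v) + Real.log c := fun j => by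
    rw [map_smul, h _ _ _ hc (f.Dinv_ne _ hv)]
  simp only [this]
  rw [Finset.sum_add_distrib, mul_add]
  simp [hd]

lemma Pn_hom (f : TorusMap 1) (hdeg : 1 < f.deg) (n : ℕ)
    (x : T2) (v : V2) (c : ℝ) (hc : 0 < c) (hv : v ≠ 0) :
    (f.P^[n] ell) x (c • v) = (f.P^[n] ell) x v + Real.log c := by
  induction n generalizing x v c with
  | zero =>
    simp only [Function.iterate_zero, id, ell]
    rw [norm_smul, Real.log_mul (by simpa using hc.ne') (by simpa using hv), Real.norm_eq_abs,
      abs_of_pos hc, add_comm]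
  | succ n ih =>
    rw [Function.iterate_succ_apply']
    exact f.P_hom hdeg (fun y v c hc hv => ih y v c hc hv) x v c hc hv

lemma continuous_fderivF (f : TorusMap 1) : Continuous (fderiv ℝ f.F) :=
  f.contDiff.continuous_fderiv (by norm_num)

lemma continuous_Dinv (f : TorusMap 1) : Continuous (fun p : V2 => f.Dinv (proj p)) := by
  have h : (fun p : V2 => f.Dinv (proj p)) = fun p => Ring.inverse (fderiv ℝ f.F p) := by
    funext p; rw [Dinv, f.D_proj]
  rw [h, continuous_iff_continuousAt]
  intro p
  have hu := f.isUnit_D (proj p)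
  rw [f.D_proj] at hu
  obtain ⟨u, hu⟩ := hu
  have h1 := NormedRing.inverse_continuousAt u
  rw [hu] at h1
  exact ContinuousAt.comp (g := Ring.inverse) h1 f.continuous_fderivF.continuousAt

lemma P_cont (f : TorusMap 1) (hdeg : 1 < f.deg) {φ : T2 → V2 → ℝ}
    (h : ContinuousOn (fun z : V2 × V2 => φ (proj z.1) z.2) {z | z.2 ≠ 0}) :
    ContinuousOn (fun z : V2 × V2 => f.P φ (proj z.1) z.2) {z | z.2 ≠ 0} := by
  obtain ⟨g, hg, hi, hr⟩ := f.exists_branches hdeg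
  simp only [f.P_branch g hi hr]
  refine continuousOn_const.mul (continuousOn_finsetSum _ fun j _ => ?_)
  have hc : Continuous (fun z : V2 × V2 => (g j z.1, f.Dinv (proj (g j z.1)) z.2)) := by
    have h1 : Continuous (fun z : V2 × V2 => g j z.1) := (hg j).comp continuous_fst
    exact h1.prodMk ((f.continuous_Dinv.comp h1).clm_apply continuous_snd)
  exact h.comp hc.continuousOn fun z hz => f.Dinv_ne _ hz

lemma Pn_cont (f : TorusMap 1) (hdeg : 1 < f.deg) (n : ℕ) :
    ContinuousOn (fun z : V2 × V2 => (f.P^[n] ell) (proj z.1) z.2) {z | z.2 ≠ 0} := by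
  induction n with
  | zero =>
    simp only [Function.iterate_zero, id, ell]
    refine ContinuousOn.log (by fun_prop) ?_
    intro z hz
    simpa using hz
  | succ n ih =>
    rw [Function.iterate_succ_apply']
    exact f.P_cont hdeg ih

lemma exists_K (f : TorusMap 1) : ∃ K : ℝ, 0 ≤ K ∧ ∀ y v, v ≠ 0 →
    ell y (f.Dinv y v) ≤ ell y v + K ∧ ell y v ≤ ell y (f.Dinv y v) + K := by
  obtain ⟨M1, h1⟩ := (isCompact_closedBall (0 : V2) 2).exists_bound_of_continuousOn
    f.continuous_Dinv.continuousOn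
  obtain ⟨M2, h2⟩ := (isCompact_closedBall (0 : V2) 2).exists_bound_of_continuousOn
    f.continuous_fderivF.continuousOn
  let M := max 1 (max M1 M2)
  have hM : 1 ≤ M := le_max_left _ _
  refine ⟨Real.log M, Real.log_nonneg hM, fun y v hv => ?_⟩
  obtain ⟨p, hp, rfl⟩ := proj_surj y
  have hp' : p ∈ Metric.closedBall (0 : V2) 2 := by simpa using hp
  have hb1 : ‖f.Dinv (proj p) v‖ ≤ ‖v‖ * M := by
    refine ((f.Dinv (proj p)).le_opNorm v).trans ?_
    rw [mul_comm]
    gcongr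
    exact (h1 p hp').trans ((le_max_left _ _).trans (le_max_right _ _))
  have hb2 : ‖v‖ ≤ ‖f.Dinv (proj p) v‖ * M := by
    conv_lhs => rw [← f.D_Dinv (proj p) v]
    refine ((f.D (proj p)).le_opNorm _).trans ?_
    rw [mul_comm]
    gcongr
    rw [f.D_proj]
    exact (h2 p hp').trans ((le_max_right _ _).trans (le_max_right _ _))
  have hv' : 0 < ‖v‖ := norm_pos_iff.2 hv
  have hw' : 0 < ‖f.Dinv (proj p) v‖ := norm_pos_iff.2 (f.Dinv_ne _ hv)
  have hM0 : 0 < M := by linarith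
  unfold ell
  constructor
  · rw [← Real.log_mul hv'.ne' hM0.ne']
    exact Real.log_le_log hw' hb1
  · rw [← Real.log_mul hw'.ne' hM0.ne']
    exact Real.log_le_log hv' hb2

lemma P_bounds (f : TorusMap 1) (hdeg : 1 < f.deg) {K c : ℝ}
    (h : ∀ y v, v ≠ 0 → ell y (f.Dinv y v) ≤ ell y v + K ∧ ell y v ≤ ell y (f.Dinv y v) + K)
    {φ : T2 → V2 → ℝ} (hφ : ∀ y v, v ≠ 0 → |φ y v - ell y v| ≤ c)
    (x : T2) (v : V2) (hv : v ≠ 0) : |f.P φ x v - ell x v| ≤ c + K := by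
  obtain ⟨g, -, hi, hr⟩ := f.exists_branches hdeg
  obtain ⟨q, rfl⟩ := proj_surj' x
  have hd : (0:ℝ) < f.deg := by positivity
  rw [f.P_branch g hi hr]
  have hb : ∀ j : Fin f.deg, |φ (proj (g j q)) (f.Dinv (proj (g j q)) v) - Real.log ‖v‖| ≤ c + K := by
    intro j
    have h1 := h (proj (g j q)) v hv
    have h2 := hφ (proj (g j q)) _ (f.Dinv_ne (proj (g j q)) hv)
    unfold ell at h1 h2
    rw [abs_le] at h2 ⊢
    constructor <;> linarith [h1.1, h1.2, h2.1, h2.2]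
  have e : (f.deg : ℝ)⁻¹ * ∑ j, φ (proj (g j q)) (f.Dinv (proj (g j q)) v) - ell (proj q) v
      = (f.deg : ℝ)⁻¹ * ∑ j, (φ (proj (g j q)) (f.Dinv (proj (g j q)) v) - Real.log ‖v‖) := by
    rw [Finset.sum_sub_distrib, mul_sub]
    simp [hd.ne', ell]
  rw [e, abs_mul, abs_of_pos (inv_pos.2 hd), inv_mul_le_iff₀ hd]
  refine (Finset.abs_sum_le_sum_abs _ _).trans ?_
  refine (Finset.sum_le_sum fun j _ => hb j).trans (le_of_eq ?_)
  simp [mul_add]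

lemma exists_bound (f : TorusMap 1) (hdeg : 1 < f.deg) : ∃ K : ℝ, 0 ≤ K ∧ ∀ n x v, v ≠ 0 →
    |(f.P^[n] ell) x v - ell x v| ≤ n * K := by
  obtain ⟨K, hK, h⟩ := f.exists_K
  refine ⟨K, hK, fun n => ?_⟩
  induction n with
  | zero => intro x v _; simp
  | succ n ih =>
    intro x v hv
    rw [Function.iterate_succ_apply']
    have := f.P_bounds hdeg h ih x v hv
    push_cast
    linarith

lemma growth (f : TorusMap 1) (hdeg : 1 < f.deg) {C : ℝ} (hC : 0 < C) (M : ℕ)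
    (h : ∀ x, ∃ n, 1 ≤ n ∧ n ≤ M ∧ ∀ v : V2, ‖v‖ = 1 → n * C ≤ f.I x v n) :
    ∃ B : ℝ, ∀ n x v, v ≠ 0 → ell x v + n * C - B ≤ (f.P^[n] ell) x v := by
  obtain ⟨K, hK, hb⟩ := f.exists_bound hdeg
  refine ⟨M * (K + C), fun n => ?_⟩
  induction n using Nat.strong_induction_on with
  | _ n ih =>
    intro x v hv
    by_cases hn : n < M
    · have h1 := (abs_le.1 (hb n x v hv)).1
      have h2 : (n : ℝ) * (K + C) ≤ M * (K + C) := by gcongr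
      linarith
    · obtain ⟨k, hk1, hkM, hk⟩ := h x
      have hkn : k ≤ n := by omega
      have e : f.P^[n] ell = f.P^[k] (f.P^[n-k] ell) := by
        rw [← Function.iterate_add_apply]; congr 2; omega
      have h1 := f.Pn_mono hdeg k (φ := fun y v => ell y v + ((n - k : ℕ) * C - M * (K + C)))
        (ψ := f.P^[n-k] ell) (fun y v hv => by
          have := ih (n - k) (by omega) y v hv
          linarith) x v hv
      rw [← e, f.Pn_add_const hdeg] at h1
      have hv' : 0 < ‖v‖ := norm_pos_iff.2 hv
      have hu : ‖(‖v‖⁻¹ • v)‖ = 1 := by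
        rw [norm_smul, norm_inv, norm_norm, inv_mul_cancel₀ hv'.ne']
      have h2 := hk _ hu
      rw [f.I_eq hdeg, f.Pn_hom hdeg k x v _ (inv_pos.2 hv') hv, Real.log_inv] at h2
      simp only at h1
      push_cast [hkn] at h1
      unfold ell at h1 h2 ⊢
      linarith

lemma growthI (f : TorusMap 1) (hdeg : 1 < f.deg) {C : ℝ} (hC : 0 < C) (M : ℕ)
    (h : ∀ x, ∃ n, 1 ≤ n ∧ n ≤ M ∧ ∀ v : V2, ‖v‖ = 1 → n * C ≤ f.I x v n) :
    ∃ B : ℝ, ∀ n x (v : V2), ‖v‖ = 1 → n * C - B ≤ f.I x v n := by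
  obtain ⟨B, hB⟩ := f.growth hdeg hC M h
  refine ⟨B, fun n x v hv => ?_⟩
  have := hB n x v (by rintro rfl; simp at hv)
  rw [f.I_eq hdeg]
  simp only [ell, hv, Real.log_one] at this ⊢
  linarith

lemma boundI (f : TorusMap 1) (hdeg : 1 < f.deg) : ∃ K : ℝ, 0 ≤ K ∧ ∀ n x (v : V2), ‖v‖ = 1 →
    |f.I x v n| ≤ n * K := by
  obtain ⟨K, hK, h⟩ := f.exists_bound hdeg
  refine ⟨K, hK, fun n x v hv => ?_⟩
  have := h n x v (by rintro rfl; simp at hv)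
  rw [f.I_eq hdeg]
  have e : ell x v = 0 := by simp [ell, hv]
  rwa [e, sub_zero] at this

instance sphere_nonempty : Nonempty (Metric.sphere (0 : V2) 1) :=
  ⟨⟨EuclideanSpace.single 0 1, by simp⟩⟩

lemma div_bounds {K a : ℝ} (hK : 0 ≤ K) (n : ℕ) (h1 : a ≤ n * K) (h2 : -(n * K) ≤ a) :
    a / n ≤ K ∧ -K ≤ a / n := by
  rcases Nat.eq_zero_or_pos n with rfl | hn
  · simp [hK]
  · have : (0:ℝ) < n := by exact_mod_cast hn
    rw [div_le_iff₀ this, le_div_iff₀ this]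
    constructor <;> linarith

lemma infv_bounds (f : TorusMap 1) {K : ℝ} (hK : 0 ≤ K)
    (h : ∀ n x (v : V2), ‖v‖ = 1 → |f.I x v n| ≤ n * K) (x : T2) (n : ℕ) :
    (⨅ v : Metric.sphere (0 : V2) 1, f.I x (v : V2) n) / n ≤ K ∧
    -K ≤ (⨅ v : Metric.sphere (0 : V2) 1, f.I x (v : V2) n) / n := by
  have hb : ∀ v : Metric.sphere (0 : V2) 1, |f.I x (v : V2) n| ≤ n * K :=
    fun v => h n x v (by simp)
  apply div_bounds hK
  · refine (ciInf_le ⟨-(n * K), ?_⟩ (Classical.arbitrary _)).trans (abs_le.1 (hb _)).2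
    rintro _ ⟨v, rfl⟩
    exact (abs_le.1 (hb v)).1
  · exact le_ciInf fun v => (abs_le.1 (hb v)).1

lemma unifInf_bounds (f : TorusMap 1) {K : ℝ} (hK : 0 ≤ K)
    (h : ∀ n x (v : V2), ‖v‖ = 1 → |f.I x v n| ≤ n * K) (n : ℕ) :
    f.unifInf n / n ≤ K ∧ -K ≤ f.unifInf n / n := by
  have hb : ∀ v : T2 × Metric.sphere (0 : V2) 1, |f.I v.1 (v.2 : V2) n| ≤ n * K :=
    fun v => h n v.1 v.2 (by simp)
  apply div_bounds hK
  · refine (ciInf_le ⟨-(n * K), ?_⟩ (Classical.arbitrary _)).trans (abs_le.1 (hb _)).2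
    rintro _ ⟨v, rfl⟩
    exact (abs_le.1 (hb v)).1
  · exact le_ciInf fun v => (abs_le.1 (hb v)).1

lemma eventually_half {C B : ℝ} (hC : 0 < C) :
    ∀ᶠ n : ℕ in atTop, ∀ a : ℝ, n * C - B ≤ a → C / 2 ≤ a / n := by
  obtain ⟨N, hN⟩ := exists_nat_gt (2 * B / C)
  filter_upwards [eventually_ge_atTop (max N 1)] with n hn a ha
  have h1 : (N : ℝ) ≤ n := by exact_mod_cast (le_max_left _ _).trans hn
  have h2 : (1 : ℝ) ≤ n := by exact_mod_cast (le_max_right _ _).trans hn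
  rw [le_div_iff₀ (by linarith)]
  rw [div_lt_iff₀ hC] at hN
  nlinarith

lemma cond1_of_growth (f : TorusMap 1) (hdeg : 1 < f.deg) {C B : ℝ} (hC : 0 < C)
    (h : ∀ n x (v : V2), ‖v‖ = 1 → n * C - B ≤ f.I x v n) : 0 < f.C := by
  obtain ⟨K, hK, hb⟩ := f.boundI hdeg
  have hbd := f.unifInf_bounds hK hb
  have : C / 2 ≤ f.C := by
    refine le_liminf_of_le ?_ ?_
    · exact IsBoundedUnder.isCoboundedUnder_ge ⟨K, by simpa using ⟨0, fun n _ => (hbd n).1⟩⟩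
    · filter_upwards [eventually_half (B := B) hC] with n hn
      exact hn _ (le_ciInf fun v => h n v.1 v.2 (by simp))
  linarith

lemma cond3_of_growth (f : TorusMap 1) (hdeg : 1 < f.deg) {C B : ℝ} (hC : 0 < C)
    (h : ∀ n x (v : V2), ‖v‖ = 1 → n * C - B ≤ f.I x v n) :
    ∃ Cc : ℝ, 0 < Cc ∧ ∀ x : T2, Cc < f.Isup x := by
  obtain ⟨K, hK, hb⟩ := f.boundI hdeg
  refine ⟨C / 4, by linarith, fun x => ?_⟩
  have hbd := f.infv_bounds hK hb x
  have : C / 2 ≤ f.Isup x := by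
    refine le_limsup_of_frequently_le (Eventually.frequently ?_)
      ⟨K, by simpa using ⟨0, fun n _ => (hbd n).1⟩⟩
    filter_upwards [eventually_half (B := B) hC] with n hn
    exact hn _ (le_ciInf fun v => h n x v (by simp))
  linarith

lemma cond2_of_growth (f : TorusMap 1) {C B : ℝ} (hC : 0 < C)
    (h : ∀ n x (v : V2), ‖v‖ = 1 → n * C - B ≤ f.I x v n) :
    ∃ N : ℕ, ∃ Cc : ℝ, 0 < Cc ∧ ∀ (x : T2) (v : V2), ‖v‖ = 1 → Cc < f.I x v N := by
  obtain ⟨N, hN⟩ := exists_nat_gt ((B + 1) / C)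
  refine ⟨N, 1, one_pos, fun x v hv => ?_⟩
  rw [div_lt_iff₀ hC] at hN
  linarith [h N x v hv]

lemma growth_of_cond2 (f : TorusMap 1) (hdeg : 1 < f.deg)
    (h : ∃ N : ℕ, ∃ Cc : ℝ, 0 < Cc ∧ ∀ (x : T2) (v : V2), ‖v‖ = 1 → Cc < f.I x v N) :
    ∃ C B : ℝ, 0 < C ∧ ∀ n x (v : V2), ‖v‖ = 1 → n * C - B ≤ f.I x v n := by
  obtain ⟨N, Cc, hC, h⟩ := h
  have hN : 1 ≤ N := by
    by_contra hN
    obtain rfl : N = 0 := by omega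
    have := h (proj 0) (EuclideanSpace.single 0 1) (by simp)
    rw [f.I_eq hdeg] at this
    simp [ell] at this
    linarith
  have hN' : (0:ℝ) < N := by exact_mod_cast hN
  obtain ⟨B, hB⟩ := f.growthI hdeg (C := Cc / N) (by positivity) N
    (fun x => ⟨N, hN, le_rfl, fun v hv => by
      rw [mul_div_cancel₀ _ hN'.ne']; exact (h x v hv).le⟩)
  exact ⟨Cc / N, B, by positivity, hB⟩

lemma growth_of_cond3 (f : TorusMap 1) (hdeg : 1 < f.deg)
    (h : ∃ Cc : ℝ, 0 < Cc ∧ ∀ x : T2, Cc < f.Isup x) :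
    ∃ C B : ℝ, 0 < C ∧ ∀ n x (v : V2), ‖v‖ = 1 → n * C - B ≤ f.I x v n := by
  obtain ⟨C, hC, h⟩ := h
  obtain ⟨K, hK, hb⟩ := f.boundI hdeg
  have key : ∀ x : T2, ∃ n : ℕ, 1 ≤ n ∧ ∀ v : V2, ‖v‖ = 1 → n * C < f.I x v n := by
    intro x
    have hbd := f.infv_bounds hK hb x
    have hco : IsBoundedUnder (· ≥ ·) atTop
        (fun n : ℕ => (⨅ v : Metric.sphere (0 : V2) 1, f.I x (v : V2) n) / n) :=
      ⟨-K, by simpa using ⟨0, fun n _ => (hbd n).2⟩⟩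
    have hfr := frequently_lt_of_lt_limsup hco.isCoboundedUnder_le (h x)
    obtain ⟨n, hn, hn1⟩ := (hfr.and_eventually (eventually_ge_atTop 1)).exists
    refine ⟨n, hn1, fun v hv => ?_⟩
    have hn' : (0:ℝ) < n := by exact_mod_cast hn1
    rw [lt_div_iff₀ hn', mul_comm] at hn
    refine hn.trans_le (ciInf_le ⟨-(n * K), ?_⟩
      (⟨v, by simpa using hv⟩ : Metric.sphere (0 : V2) 1))
    rintro _ ⟨w, rfl⟩
    exact (abs_le.1 (hb n x w (by simp))).1
  choose N hN1 hN using key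
  have hnhd : ∀ q : V2, {q' : V2 | ∀ v ∈ Metric.sphere (0 : V2) 1,
      N (proj q) * C < f.I (proj q') v (N (proj q))} ∈ 𝓝 q := by
    intro q
    refine (isCompact_sphere (0 : V2) 1).eventually_forall_of_forall_eventually ?_
    intro v hv
    have hv1 : ‖v‖ = 1 := by simpa using hv
    have hv0 : v ≠ 0 := by rintro rfl; simp at hv1
    have ho : IsOpen {z : V2 × V2 | z.2 ≠ 0} := isOpen_ne_fun continuous_snd continuous_const
    have hc : ContinuousAt (fun z : V2 × V2 => (f.P^[N (proj q)] ell) (proj z.1) z.2) (q, v) :=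
      (f.Pn_cont hdeg (N (proj q))).continuousAt (ho.mem_nhds hv0)
    have h1 := hN (proj q) v hv1
    simp only [f.I_eq hdeg] at h1 ⊢
    exact hc.eventually_const_lt h1
  obtain ⟨t, -, ht⟩ := (isCompact_closedBall (0 : V2) 2).elim_nhds_subcover _ fun q _ => hnhd q
  obtain ⟨B, hB⟩ := f.growthI hdeg hC (t.sup fun q => N (proj q)) (by
    intro x
    obtain ⟨p, hp, rfl⟩ := proj_surj x
    have := ht (show p ∈ Metric.closedBall (0 : V2) 2 by simpa using hp)
    simp only [mem_iUnion] at this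
    obtain ⟨q, hq, hpq⟩ := this
    exact ⟨N (proj q), hN1 _, Finset.le_sup (f := fun q => N (proj q)) hq,
      fun v hv => (hpq v (by simpa using hv)).le⟩)
  exact ⟨C, B, hC, hB⟩

lemma cond2_of_cond1 (f : TorusMap 1) (h : 0 < f.C) :
    ∃ N : ℕ, ∃ Cc : ℝ, 0 < Cc ∧ ∀ (x : T2) (v : V2), ‖v‖ = 1 → Cc < f.I x v N := by
  unfold C at h
  rw [liminf_eq] at h
  have : ∃ a ∈ {a : ℝ | ∀ᶠ n : ℕ in atTop, a ≤ f.unifInf n / n}, 0 < a := by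
    by_contra! hcon
    exact absurd (Real.sSup_nonpos hcon) (not_le.2 h)
  obtain ⟨a, ha, ha0⟩ := this
  obtain ⟨n, hn, hn1⟩ := (ha.and (eventually_ge_atTop 1)).exists
  have hn' : (0:ℝ) < n := by exact_mod_cast hn1
  have hpos : 0 < f.unifInf n := by
    have := ha0.trans_le hn
    rw [lt_div_iff₀ hn'] at this
    linarith
  refine ⟨n, f.unifInf n / 2, by linarith, fun x v hv => ?_⟩
  have hbdd : BddBelow (range fun xv : T2 × Metric.sphere (0 : V2) 1 => f.I xv.1 (xv.2 : V2) n) := by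
    by_contra hnb
    have := Real.sInf_of_not_bddBelow hnb
    exact hpos.ne' this
  have : f.unifInf n ≤ f.I x v n := ciInf_le hbdd (x, ⟨v, by simpa using hv⟩)
  linarith

end TorusMap

/-- For a `C¹` local diffeomorphism `f` of the 2-torus of degree `d > 1`,
the following are equivalent: (1) `liminf_n (1/n) inf_{(x,v) ∈ T¹𝕋²} I(x,v;fⁿ) > 0`;
(2) there are `N ∈ ℕ` and `C > 0` with `I(x,v;f^N) > C` for every `(x,v) ∈ T¹𝕋²`;
(3) there is `C > 0` with `I_f(x) > C` for every `x ∈ 𝕋²`. -/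
theorem inverse_expanding_on_average_equiv (f : TorusMap 1) (hdeg : 1 < f.deg) :
    ((0 < f.C) ↔
      (∃ N : ℕ, ∃ Cc : ℝ, 0 < Cc ∧ ∀ (x : T2) (v : V2), ‖v‖ = 1 → Cc < f.I x v N)) ∧
    ((∃ N : ℕ, ∃ Cc : ℝ, 0 < Cc ∧ ∀ (x : T2) (v : V2), ‖v‖ = 1 → Cc < f.I x v N) ↔
      (∃ Cc : ℝ, 0 < Cc ∧ ∀ x : T2, Cc < f.Isup x)) := by
  have h12 : 0 < f.C → _ := f.cond2_of_cond1
  refine ⟨⟨h12, fun h => ?_⟩, ⟨fun h => ?_, fun h => ?_⟩⟩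
  · obtain ⟨C, B, hC, hB⟩ := f.growth_of_cond2 hdeg h
    exact f.cond1_of_growth hdeg hC hB
  · obtain ⟨C, B, hC, hB⟩ := f.growth_of_cond2 hdeg h
    exact f.cond3_of_growth hdeg hC hB
  · obtain ⟨C, B, hC, hB⟩ := f.growth_of_cond3 hdeg h
    exact f.cond2_of_growth hC hB

end
end
end

section
/- Let f be a C² local diffeomorphism of 𝕋² of degree d ≥ 2 with C(f) > 0 and inf_{x∈𝕋²} |det Df_x| > 1. Then for every x∈𝕋², for p_x-almost every backward orbit x̂ = (x₀,x₁,x₂,…) of x, there exists a one-dimensional linear subspace E^u(x̂) ⊆ ℝ² such that: for every nonzero v∈E^u(x̂), limsup_{n→∞} (1/n) log‖(Dfⁿ_{x_n})^{−1}·v‖ ≤ −C(f); and for every v∈ℝ²∖E^u(x̂), liminf_{n→∞} (1/n) log‖(Dfⁿ_{x_n})^{−1}·v‖ ≥ C(f). -/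
open MeasureTheory Filter Topology Set
open scoped ENNReal NNReal

noncomputable section


open MeasureTheory Filter Topology Set
open scoped ENNReal NNReal

noncomputable section

/-- `ω` is a backward orbit of `x` under `f`. -/
def IsBackward {r : ℕ} (f : TorusMap r) (x : T2) (ω : ℕ → T2) : Prop :=
  ω 0 = x ∧ ∀ k, f.toFun (ω (k + 1)) = ω k

/-- The space of backward orbits of `x` under `f`. -/
abbrev Bw {r : ℕ} (f : TorusMap r) (x : T2) : Type := {ω : ℕ → T2 // IsBackward f x ω}

/-- `p` is the uniformly distributed (Bernoulli) measure on the backward orbits of `x`: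
each of the `dⁿ` preimages `z ∈ f^{-n}(x)` carries mass `d^{-n}`. -/
def IsBernoulliBw {r : ℕ} (f : TorusMap r) (x : T2) (p : Measure (Bw f x)) : Prop :=
  IsProbabilityMeasure p ∧
    ∀ (n : ℕ) (z : T2), f.toFun^[n] z = x →
      p {ω : Bw f x | ω.1 n = z} = ((f.deg : ℝ≥0∞) ^ n)⁻¹

/-- The `C^k` distance between two torus maps: sup distance between the values plus the sup
norms of the differences of the derivatives up to order `k`, computed via the lifts. -/
def distC {r : ℕ} (k : ℕ) (f g : TorusMap r) : ℝ :=
  (⨆ x : T2, dist (f.toFun x) (g.toFun x)) +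
    ∑ i ∈ Finset.Icc 1 k, ⨆ p : V2, ‖iteratedFDeriv ℝ i f.F p - iteratedFDeriv ℝ i g.F p‖

/-- The length of the curve `σ` (parametrized on `[-1,1]`). -/
def clen (σ : ℝ → V2) : ℝ := ∫ t in (-1 : ℝ)..1, ‖deriv σ t‖

open scoped RealInnerProductSpace

/-- `σ` is an `L`-Lipschitz graph centered at `x = σ(s₀)`: in the orthogonal splitting
`T_x𝕋² = ℝσ'(s₀) ⊕ ℝσ'(s₀)^⊥`, the curve coincides with (the exponential of) the graph of
an `L`-Lipschitz function. -/
def IsLipGraph (L : ℝ≥0) (σ : ℝ → V2) (s₀ : ℝ) : Prop :=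
  ∃ (u w : V2) (φ : ℝ → ℝ) (J : Set ℝ),
    ‖u‖ = 1 ∧ ‖w‖ = 1 ∧ ⟪u, w⟫ = 0 ∧ (∃ c : ℝ, 0 < c ∧ deriv σ s₀ = c • u) ∧
    LipschitzOnWith L φ J ∧
    σ '' Set.Icc (-1 : ℝ) 1 = (fun t => σ s₀ + t • u + φ t • w) '' J

/-- The cone of width `ε` around the direction `v`. -/
def cone (v : V2) (ε : ℝ) : Set V2 := {w | ‖w - ⟪w, v⟫ • v‖ ≤ ε * |⟪w, v⟫|}



namespace UD

/-- area form -/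
def area (u v : V2) : ℝ := u 0 * v 1 - u 1 * v 0

lemma area_map (L : V2 →L[ℝ] V2) (u v : V2) :
    area (L u) (L v) = LinearMap.det (L : V2 →ₗ[ℝ] V2) * area u v := by
  have h := (EuclideanSpace.basisFun (Fin 2) ℝ).toBasis.det_comp (L : V2 →ₗ[ℝ] V2) ![u, v]
  simp [Module.Basis.det_apply, Matrix.det_fin_two, Module.Basis.toMatrix_apply] at h
  unfold area
  linarith

lemma area_sq (u v : V2) : area u v ^ 2 + (inner ℝ u v) ^ 2 = ‖u‖ ^ 2 * ‖v‖ ^ 2 := by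
  rw [EuclideanSpace.norm_sq_eq, EuclideanSpace.norm_sq_eq]
  simp [area, PiLp.inner_apply, Fin.sum_univ_two]
  ring

lemma proj_surj (z : T2) : ∃ p : V2, (∀ i, p i ∈ Set.Icc (0:ℝ) 1) ∧ proj p = z := by
  obtain ⟨a, b⟩ := z
  have key : ∀ a : AddCircle (1:ℝ), ∃ s : ℝ, s ∈ Set.Icc (0:ℝ) 1 ∧ (s : AddCircle (1:ℝ)) = a := by
    intro a
    obtain ⟨s, hs, h⟩ := (AddCircle.coe_image_Icc_eq (1:ℝ) 0).symm ▸ Set.mem_univ a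
    exact ⟨s, by simpa using hs, h⟩
  obtain ⟨s, hs, rfl⟩ := key a
  obtain ⟨t, ht, rfl⟩ := key b
  refine ⟨!₂[s, t], ?_, ?_⟩
  · intro i; fin_cases i <;> simpa
  · simp [proj]

variable (f : TorusMap 2)

lemma exists_bound : ∃ K : ℝ, 1 ≤ K ∧ ∀ z, ‖f.D z‖ ≤ K ∧ ‖Ring.inverse (f.D z)‖ ≤ K := by
  have hcont : Continuous (fderiv ℝ f.F) := f.contDiff.continuous_fderiv (by norm_num)
  have hcomp : IsCompact {p : V2 | ∀ i, p i ∈ Set.Icc (0:ℝ) 1} := by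
    have h1 : IsCompact (Set.pi Set.univ (fun _ : Fin 2 => Set.Icc (0:ℝ) 1)) :=
      isCompact_univ_pi (fun _ => isCompact_Icc)
    have h2 := h1.image (PiLp.continuous_toLp 2 (fun _ : Fin 2 => ℝ))
    convert h2 using 1
    ext p
    constructor
    · intro hp
      exact ⟨p.ofLp, fun i _ => hp i, rfl⟩
    · rintro ⟨q, hq, rfl⟩ i
      exact hq i trivial
  have hinv : Continuous (fun p => Ring.inverse (fderiv ℝ f.F p)) := by
    rw [continuous_iff_continuousAt]
    intro p
    have hu : IsUnit (fderiv ℝ f.F p) := f.D_proj p ▸ f.isUnit_D (proj p)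
    obtain ⟨u, hu⟩ := hu
    have := NormedRing.inverse_continuousAt u
    rw [hu] at this
    exact ContinuousAt.comp (f := fderiv ℝ f.F) this hcont.continuousAt
  obtain ⟨K1, h1⟩ := hcomp.exists_bound_of_continuousOn hcont.continuousOn
  obtain ⟨K2, h2⟩ := hcomp.exists_bound_of_continuousOn hinv.continuousOn
  refine ⟨max 1 (max K1 K2), le_max_left _ _, ?_⟩
  intro z
  obtain ⟨p, hp, rfl⟩ := proj_surj z
  rw [f.D_proj]
  exact ⟨(h1 p hp).trans (by simp), (h2 p hp).trans (by simp)⟩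

lemma isUnit_Dn (n : ℕ) : ∀ z, IsUnit (f.Dn n z) := by
  induction n with
  | zero => intro z; exact isUnit_one
  | succ n ih => intro z; exact (ih _).mul (f.isUnit_D z)

lemma Dn_add (n m : ℕ) : ∀ z, f.Dn (n + m) z = f.Dn n (f.toFun^[m] z) * f.Dn m z := by
  induction m with
  | zero => intro z; exact (mul_one _).symm
  | succ m ih =>
    intro z
    change f.Dn (n + m) (f.toFun z) * f.D z = _ * (f.Dn m (f.toFun z) * f.D z)
    rw [ih, Function.iterate_succ_apply, mul_assoc]

lemma ring_inverse_mul {R : Type*} [Ring R] {a b : R} (ha : IsUnit a) (hb : IsUnit b) :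
    Ring.inverse (a * b) = Ring.inverse b * Ring.inverse a := by
  obtain ⟨a, rfl⟩ := ha
  obtain ⟨b, rfl⟩ := hb
  rw [← Units.val_mul, Ring.inverse_unit, Ring.inverse_unit, Ring.inverse_unit, mul_inv_rev,
    Units.val_mul]

lemma Dninv_add (n m : ℕ) (z : T2) (v : V2) :
    f.Dninv (n + m) z v = f.Dninv m z (f.Dninv n (f.toFun^[m] z) v) := by
  unfold TorusMap.Dninv
  rw [Dn_add, ring_inverse_mul (isUnit_Dn f _ _) (isUnit_Dn f _ _)]
  rfl

lemma Dninv_zero (z : T2) (v : V2) : f.Dninv 0 z v = v := by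
  have : f.Dninv 0 z = 1 := Ring.inverse_one _
  rw [this]; rfl

lemma Dninv_one (z : T2) : f.Dninv 1 z = Ring.inverse (f.D z) := by
  have : f.Dn 1 z = f.D z := one_mul (f.D z)
  rw [TorusMap.Dninv, this]

lemma D_inv_apply (z : T2) (v : V2) : f.D z (Ring.inverse (f.D z) v) = v := by
  have := Ring.mul_inverse_cancel _ (f.isUnit_D z)
  exact congrArg (fun L : V2 →L[ℝ] V2 => L v) this

lemma step_bounds {K : ℝ} (hK : ∀ z, ‖f.D z‖ ≤ K ∧ ‖Ring.inverse (f.D z)‖ ≤ K) (z : T2) (v : V2) :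
    ‖f.Dninv 1 z v‖ ≤ K * ‖v‖ ∧ ‖v‖ ≤ K * ‖f.Dninv 1 z v‖ := by
  rw [Dninv_one]
  refine ⟨(ContinuousLinearMap.le_opNorm _ _).trans (by gcongr; exact (hK z).2), ?_⟩
  conv_lhs => rw [← D_inv_apply f z v]
  exact (ContinuousLinearMap.le_opNorm _ _).trans (by gcongr; exact (hK z).1)

lemma area_step (hdet : 1 < ⨅ x : T2, |f.detD x|) (z : T2) (u v : V2) :
    |area (f.Dninv 1 z u) (f.Dninv 1 z v)| ≤ |area u v| := by
  have h1 : 1 < |f.detD z| := lt_of_lt_of_le hdet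
    (ciInf_le ⟨0, by rintro _ ⟨y, rfl⟩; exact abs_nonneg _⟩ z)
  have h2 := area_map (f.D z) (f.Dninv 1 z u) (f.Dninv 1 z v)
  rw [Dninv_one, D_inv_apply, D_inv_apply] at h2
  rw [Dninv_one, h2, abs_mul]
  exact le_mul_of_one_le_left (abs_nonneg _) h1.le

lemma log_bounds {K : ℝ} (hK1 : 1 ≤ K) (hK : ∀ z, ‖f.D z‖ ≤ K ∧ ‖Ring.inverse (f.D z)‖ ≤ K)
    (m : ℕ) : ∀ (z : T2) (v : V2), v ≠ 0 →
    f.Dninv m z v ≠ 0 ∧ |Real.log ‖f.Dninv m z v‖ - Real.log ‖v‖| ≤ m * Real.log K := by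
  induction m with
  | zero => intro z v hv; rw [Dninv_zero]; simp [hv]
  | succ m ih =>
    intro z v hv
    rw [Dninv_add f m 1]
    obtain ⟨h1, h2⟩ := ih (f.toFun^[1] z) v hv
    set w := f.Dninv m (f.toFun^[1] z) v
    obtain ⟨h3, h4⟩ := step_bounds f hK z w
    have hw : 0 < ‖w‖ := norm_pos_iff.2 h1
    have h5 : 0 < ‖f.Dninv 1 z w‖ := by
      by_contra hcon
      have : ‖f.Dninv 1 z w‖ = 0 := le_antisymm (not_lt.1 hcon) (norm_nonneg _)
      rw [this] at h4; linarith
    refine ⟨norm_pos_iff.1 h5, ?_⟩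
    have hK0 : 0 < K := by linarith
    have h6 := Real.log_le_log h5 h3
    have h7 := Real.log_le_log hw h4
    rw [Real.log_mul hK0.ne' hw.ne'] at h6
    rw [Real.log_mul hK0.ne' h5.ne'] at h7
    rw [abs_le] at h2 ⊢
    push_cast
    constructor <;> linarith [h2.1, h2.2]


lemma real_core (a t : ℕ → ℝ) (K C : ℝ) (ha : ∀ n, 0 < a n) (hK : 0 ≤ K)
    (ht : ∀ n, |t (n + 1) - t n| ≤ K / (a n * a (n + 1))) (hC : 0 < C)
    (hg : ∀ c, 0 < c → c < C → ∀ δ > 0, ∃ n0 : ℕ, ∀ n ≥ n0, ∀ k ≥ n,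
      c * ((k : ℝ) - n) - δ * k ≤ Real.log (a k) - Real.log (a n)) :
    ∃ T : ℝ, ∀ b, 0 < b → b < C → ∃ R > 0, ∃ n0 : ℕ, ∀ n ≥ n0,
      |t n - T| * a n ≤ R * Real.exp (-b * n) ∧ Real.exp (b * n) ≤ R * a n := by
  have main : ∀ b, 0 < b → b < C → ∃ ρ > 0, ∃ n0 : ℕ, ∀ n ≥ n0,
      Real.exp (b * n) * ρ ≤ a n ∧
      ∀ j : ℕ, dist (t (n + j)) (t (n + (j + 1))) ≤
        (K / (a n * ρ) * Real.exp (-b * n)) * Real.exp (-b) ^ j := by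
    intro b hb hbC
    obtain ⟨n0, h0⟩ := hg ((C + b) / 2) (by linarith) (by linarith) ((C - b) / 4) (by linarith)
    set c := (C + b) / 2 with hc
    set δ := (C - b) / 4 with hδ
    have hcd : c - 2 * δ = b := by rw [hc, hδ]; ring
    have hδ0 : 0 < δ := by rw [hδ]; linarith
    have grow : ∀ n ≥ n0, ∀ k ≥ n, a n * Real.exp (c * ((k : ℝ) - n) - δ * k) ≤ a k := by
      intro n hn k hk
      have := h0 n hn k hk
      calc a n * Real.exp (c * ((k : ℝ) - n) - δ * k)
          = Real.exp (Real.log (a n) + (c * ((k : ℝ) - n) - δ * k)) := by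
            rw [Real.exp_add, Real.exp_log (ha n)]
        _ ≤ Real.exp (Real.log (a k)) := Real.exp_le_exp.2 (by linarith)
        _ = a k := Real.exp_log (ha k)
    refine ⟨a n0 * Real.exp (-c * n0), mul_pos (ha _) (Real.exp_pos _), n0, ?_⟩
    set ρ := a n0 * Real.exp (-c * n0) with hρ
    have hρ0 : 0 < ρ := mul_pos (ha _) (Real.exp_pos _)
    have grow2 : ∀ k ≥ n0, Real.exp ((c - δ) * k) * ρ ≤ a k := by
      intro k hk
      refine le_trans (le_of_eq ?_) (grow n0 le_rfl k hk)
      rw [hρ, mul_left_comm, ← Real.exp_add]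
      congr 2; ring
    intro n hn
    refine ⟨le_trans ?_ (grow2 n hn), ?_⟩
    · gcongr; linarith
    · intro j
      have g1 := grow n hn (n + j) (by omega)
      have g2 := grow2 (n + j + 1) (by omega)
      rw [dist_comm, Real.dist_eq]
      refine (ht (n + j)).trans ?_
      have hprod : a n * ρ * Real.exp (b * n + b * j) ≤ a (n + j) * a (n + j + 1) := by
        calc a n * ρ * Real.exp (b * n + b * j)
            ≤ a n * ρ * Real.exp ((c * (((n + j : ℕ) : ℝ) - n) - δ * ((n + j : ℕ) : ℝ))
                + (c - δ) * ((n + j + 1 : ℕ) : ℝ)) := by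
              have := (ha n).le
              refine mul_le_mul_of_nonneg_left (Real.exp_le_exp.2 ?_) (by positivity)
              push_cast
              have hj : (0 : ℝ) ≤ j := Nat.cast_nonneg j
              have hn' : (0 : ℝ) ≤ n := Nat.cast_nonneg n
              have e1 : 0 ≤ (c - δ) * j := mul_nonneg (by linarith) hj
              have e2 : 0 ≤ δ * j := mul_nonneg hδ0.le hj
              have : b = c - 2 * δ := hcd.symm
              rw [this]
              nlinarith
          _ = (a n * Real.exp (c * (((n + j : ℕ) : ℝ) - n) - δ * ((n + j : ℕ) : ℝ))) *
                (Real.exp ((c - δ) * ((n + j + 1 : ℕ) : ℝ)) * ρ) := by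
              rw [Real.exp_add]; ring
          _ ≤ _ := mul_le_mul g1 g2 (by positivity) (ha _).le
      have hpos : 0 < a n * ρ * Real.exp (b * n + b * j) :=
        mul_pos (mul_pos (ha n) hρ0) (Real.exp_pos _)
      calc K / (a (n + j) * a (n + j + 1)) ≤ K / (a n * ρ * Real.exp (b * n + b * j)) := by
            gcongr
        _ = _ := by
            rw [← Real.exp_nat_mul, mul_assoc (K / (a n * ρ)), ← Real.exp_add,
              show -b * (n:ℝ) + j * (-b) = -(b * n + b * j) by ring, Real.exp_neg]
            rw [div_mul_eq_div_div (K) (a n * ρ), div_eq_mul_inv (K / (a n * ρ))]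
  have hlim : ∃ T, Tendsto t atTop (𝓝 T) := by
    obtain ⟨ρ, hρ, n0, h⟩ := main (C / 2) (by linarith) (by linarith)
    have hc : CauchySeq (fun j => t (n0 + j)) :=
      cauchySeq_of_le_geometric _ _ (Real.exp_lt_one_iff.2 (by linarith)) (h n0 le_rfl).2
    obtain ⟨T, hT⟩ := cauchySeq_tendsto_of_complete hc
    refine ⟨T, ?_⟩
    rw [← tendsto_add_atTop_iff_nat n0]
    simpa [add_comm] using hT
  obtain ⟨T, hT⟩ := hlim
  refine ⟨T, fun b hb hbC => ?_⟩
  obtain ⟨ρ, hρ, n0, h⟩ := main b hb hbC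
  have hr : 0 < 1 - Real.exp (-b) := by
    have : Real.exp (-b) < 1 := Real.exp_lt_one_iff.2 (by linarith)
    linarith
  refine ⟨K / ρ / (1 - Real.exp (-b)) + ρ⁻¹, by positivity, n0, fun n hn => ?_⟩
  obtain ⟨h1, h2⟩ := h n hn
  have han := ha n
  constructor
  · have h3 := dist_le_of_le_geometric_of_tendsto₀ (f := fun j => t (n + j)) _ _ (by linarith) h2
      (a := T) (by
        have := (tendsto_add_atTop_iff_nat n).2 hT
        simpa [add_comm] using this)
    simp only [add_zero, Real.dist_eq] at h3
    calc |t n - T| * a n ≤ (K / (a n * ρ) * Real.exp (-b * n) / (1 - Real.exp (-b))) * a n := by gcongr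
      _ = K / ρ / (1 - Real.exp (-b)) * Real.exp (-b * n) := by field_simp
      _ ≤ _ := by
        gcongr
        have : 0 < ρ⁻¹ := by positivity
        linarith
  · calc Real.exp (b * n) ≤ ρ⁻¹ * a n := by
          rw [inv_mul_eq_div, le_div_iff₀ hρ]; exact h1
      _ ≤ _ := by
        gcongr
        have : 0 ≤ K / ρ / (1 - Real.exp (-b)) := by positivity
        linarith

/-- first basis vector -/
def e0 : V2 := !₂[1, 0]
/-- second basis vector -/
def e1 : V2 := !₂[0, 1]

lemma e_decomp (v : V2) : v = v 0 • e0 + v 1 • e1 := by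
  ext i; fin_cases i <;> simp [e0, e1]

lemma area_add_smul (u v : V2) (s : ℝ) : area (u + s • v) v = area u v := by
  simp [area]; ring

lemma core (A : ℕ → V2 →L[ℝ] V2) (K C : ℝ) (hK : 1 ≤ K)
    (hup : ∀ n u, ‖A (n + 1) u‖ ≤ K * ‖A n u‖)
    (hne : ∀ n u, u ≠ 0 → A n u ≠ 0)
    (harea : ∀ n, |area (A n e1) (A n e0)| ≤ 1) (hC : 0 < C)
    (hg : ∀ c, 0 < c → c < C → ∀ δ > 0, ∃ n0 : ℕ, ∀ n ≥ n0, ∀ k ≥ n,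
      c * ((k : ℝ) - n) - δ * k ≤ Real.log ‖A k e0‖ - Real.log ‖A n e0‖) :
    ∃ E : Submodule ℝ V2, Module.finrank ℝ E = 1 ∧
      (∀ v ∈ E, v ≠ 0 → ∀ b, 0 < b → b < C → ∃ R > 0, ∀ᶠ n : ℕ in atTop,
        ‖A n v‖ ≤ R * Real.exp (-b * n)) ∧
      (∀ v, v ∉ E → ∀ b, 0 < b → b < C → ∃ R > 0, ∀ᶠ n : ℕ in atTop,
        Real.exp (b * n) ≤ R * ‖A n v‖) := by
  have he0 : e0 ≠ 0 := by
    intro h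
    have := congrArg (fun v : V2 => v 0) h
    simp [e0] at this
  set a : ℕ → ℝ := fun n => ‖A n e0‖ with ha_def
  have ha : ∀ n, 0 < a n := fun n => norm_pos_iff.2 (hne n e0 he0)
  set t : ℕ → ℝ := fun n => -(inner ℝ (A n e1) (A n e0)) / a n ^ 2 with ht_def
  have horth : ∀ n, inner ℝ (A n (e1 + t n • e0)) (A n e0) = 0 := by
    intro n
    have := (ha n).ne'
    rw [map_add, map_smul, inner_add_left, inner_smul_left, real_inner_self_eq_norm_sq]
    simp only [ht_def]
    change _ + _ * a n ^ 2 = 0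
    simp
    field_simp
    ring
  have hnorm : ∀ n, ‖A n (e1 + t n • e0)‖ ≤ 1 / a n := by
    intro n
    rw [le_div_iff₀ (ha n)]
    have h1 := area_sq (A n (e1 + t n • e0)) (A n e0)
    rw [horth, map_add, map_smul, area_add_smul] at h1
    rw [map_add, map_smul]
    have h2 := harea n
    have h3 : area (A n e1) (A n e0) ^ 2 ≤ 1 := by
      rw [← sq_abs]; exact pow_le_one₀ (abs_nonneg _) h2
    have h4 : (‖A n e1 + t n • A n e0‖ * a n) ^ 2 ≤ 1 := by
      rw [mul_pow]; simp only [ha_def]; linarith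
    exact (sq_le_one_iff₀ (by have := (ha n).le; positivity)).1 h4
  have hdecomp : ∀ n s, A n (e1 + s • e0) = A n (e1 + t n • e0) + (s - t n) • A n e0 := by
    intro n s
    rw [map_add, map_add, map_smul, map_smul, sub_smul]; abel
  have ht : ∀ n, |t (n + 1) - t n| ≤ K / (a n * a (n + 1)) := by
    intro n
    have h1 := hdecomp (n + 1) (t n)
    have h2 : inner ℝ (A (n + 1) (e1 + t n • e0)) (A (n + 1) e0) =
        (t n - t (n + 1)) * a (n + 1) ^ 2 := by
      rw [h1, inner_add_left, horth, inner_smul_left, real_inner_self_eq_norm_sq]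
      simp [ha_def]
    have h3 := abs_real_inner_le_norm (A (n + 1) (e1 + t n • e0)) (A (n + 1) e0)
    rw [h2, abs_mul, abs_of_nonneg (sq_nonneg (a (n + 1)))] at h3
    have h4 : |t n - t (n + 1)| * a (n + 1) ≤ ‖A (n + 1) (e1 + t n • e0)‖ := by
      have h5 := ha (n + 1)
      change _ ≤ _ * a (n + 1) at h3
      refine le_of_mul_le_mul_right ?_ h5
      linarith [h3]
    have h5 : ‖A (n + 1) (e1 + t n • e0)‖ ≤ K * (1 / a n) :=
      (hup n _).trans (by gcongr; exact hnorm n)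
    rw [abs_sub_comm, mul_comm (a n), ← div_div, div_right_comm, le_div_iff₀ (ha (n + 1))]
    calc _ ≤ _ := h4
      _ ≤ _ := h5
      _ = _ := by ring
  obtain ⟨T, hT⟩ := real_core a t K C ha (by linarith) ht hC hg
  have hcontr : ∀ b, 0 < b → b < C → ∃ R > 0, ∃ n0 : ℕ, ∀ n ≥ n0,
      ‖A n (e1 + T • e0)‖ ≤ R * Real.exp (-b * n) ∧ Real.exp (b * n) ≤ R * a n := by
    intro b hb hbC
    obtain ⟨R, hR, n0, h⟩ := hT b hb hbC
    refine ⟨2 * R, by positivity, n0, fun n hn => ?_⟩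
    obtain ⟨h1, h2⟩ := h n hn
    have := ha n
    constructor
    · rw [hdecomp]
      refine (norm_add_le _ _).trans ?_
      rw [norm_smul, Real.norm_eq_abs, abs_sub_comm]
      have h3 : 1 / a n ≤ R * Real.exp (-b * n) := by
        rw [neg_mul, Real.exp_neg, div_le_iff₀ this]
        rw [mul_assoc, mul_comm, mul_assoc, inv_mul_eq_div, le_div_iff₀ (Real.exp_pos _)]
        linarith
      have h4 := hnorm n
      change _ + |t n - T| * a n ≤ _
      linarith
    · nlinarith
  have hw : e1 + T • e0 ≠ 0 := by
    intro h
    have := congrArg (fun v : V2 => v 1) h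
    simp [e0, e1] at this
  refine ⟨Submodule.span ℝ {e1 + T • e0}, finrank_span_singleton hw, ?_, ?_⟩
  · intro v hv hv0 b hb hbC
    obtain ⟨s, rfl⟩ := Submodule.mem_span_singleton.1 hv
    obtain ⟨R, hR, n0, h⟩ := hcontr b hb hbC
    have hs : s ≠ 0 := by rintro rfl; simp at hv0
    refine ⟨|s| * R, by positivity, eventually_atTop.2 ⟨n0, fun n hn => ?_⟩⟩
    rw [map_smul, norm_smul, Real.norm_eq_abs, mul_assoc]
    gcongr
    exact (h n hn).1
  · intro v hv b hb hbC
    obtain ⟨R, hR, n0, h⟩ := hcontr b hb hbC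
    set β := v 0 - T * v 1 with hβ
    have hvd : v = v 1 • (e1 + T • e0) + β • e0 := by
      conv_lhs => rw [e_decomp v]
      rw [hβ]; module
    have hβ0 : β ≠ 0 := by
      intro h0
      apply hv
      rw [hvd, h0, zero_smul, add_zero]
      exact Submodule.smul_mem _ _ (Submodule.mem_span_singleton_self _)
    have hβp : 0 < |β| := abs_pos.2 hβ0
    have hlow : ∀ n, |β| * a n ≤ ‖A n v‖ + |v 1| * ‖A n (e1 + T • e0)‖ := by
      intro n
      have : β • A n e0 = A n v - v 1 • A n (e1 + T • e0) := by
        conv_rhs => rw [hvd]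
        rw [map_add, map_smul, map_smul]
        simp [e0, e1, hβ]
      calc |β| * a n = ‖β • A n e0‖ := by rw [norm_smul, Real.norm_eq_abs]
        _ ≤ _ := by rw [this, ← Real.norm_eq_abs, ← norm_smul]; exact norm_sub_le _ _
    have hlim : Tendsto (fun n : ℕ => Real.exp (b * n)) atTop atTop :=
      Real.tendsto_exp_atTop.comp (tendsto_natCast_atTop_atTop.const_mul_atTop hb)
    have hev := hlim.eventually_ge_atTop (1 + 2 * R * (|v 1| * R) / |β|)
    refine ⟨2 * R / |β|, by positivity, ?_⟩
    filter_upwards [hev, eventually_ge_atTop n0] with n h1 hn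
    obtain ⟨h2, h3⟩ := h n hn
    have h4 := hlow n
    have h5 : Real.exp (-b * n) ≤ 1 := Real.exp_le_one_iff.2 (by
      have : (0:ℝ) ≤ n := Nat.cast_nonneg n
      nlinarith)
    have h6 : ‖A n (e1 + T • e0)‖ ≤ R := h2.trans (mul_le_of_le_one_right hR.le h5)
    have h7 : |β| * a n ≤ ‖A n v‖ + |v 1| * R := h4.trans (by gcongr)
    have h8 : 2 * R * (|v 1| * R) ≤ |β| * Real.exp (b * n) := by
      have : 2 * R * (|v 1| * R) / |β| ≤ Real.exp (b * n) := by linarith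
      rw [div_le_iff₀ hβp] at this
      linarith
    rw [div_mul_eq_mul_div, le_div_iff₀ hβp]
    have h9 : |β| * Real.exp (b * n) ≤ R * (|β| * a n) := by
      calc |β| * Real.exp (b * n) ≤ |β| * (R * a n) := by gcongr
        _ = _ := by ring
    have h10 : R * (|β| * a n) ≤ R * (‖A n v‖ + |v 1| * R) := by gcongr
    nlinarith

lemma tendsto_const_div (R : ℝ) : Tendsto (fun n : ℕ => R / (n : ℝ)) atTop (𝓝 0) :=
  tendsto_const_div_atTop_nhds_zero_nat R

/-- passing to the limsup / liminf -/
lemma core_lim (A : ℕ → V2 →L[ℝ] V2) (K C : ℝ) (hK : 1 ≤ K)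
    (hup : ∀ n u, ‖A (n + 1) u‖ ≤ K * ‖A n u‖)
    (hne : ∀ n u, u ≠ 0 → A n u ≠ 0)
    (hlog : ∀ n u, u ≠ 0 → |Real.log ‖A n u‖ - Real.log ‖u‖| ≤ n * Real.log K)
    (harea : ∀ n, |area (A n e1) (A n e0)| ≤ 1) (hC : 0 < C)
    (hg : ∀ c, 0 < c → c < C → ∀ δ > 0, ∃ n0 : ℕ, ∀ n ≥ n0, ∀ k ≥ n,
      c * ((k : ℝ) - n) - δ * k ≤ Real.log ‖A k e0‖ - Real.log ‖A n e0‖) :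
    ∃ E : Submodule ℝ V2, Module.finrank ℝ E = 1 ∧
      (∀ v ∈ E, v ≠ 0 →
          Filter.limsup (fun n : ℕ => Real.log ‖A n v‖ / n) Filter.atTop ≤ -C) ∧
      (∀ v : V2, v ∉ E →
          C ≤ Filter.liminf (fun n : ℕ => Real.log ‖A n v‖ / n) Filter.atTop) := by
  obtain ⟨E, hE, h1, h2⟩ := core A K C hK hup hne harea hC hg
  have hbd : ∀ v, v ≠ 0 → ∀ᶠ n : ℕ in atTop,
      |Real.log ‖A n v‖ / n| ≤ Real.log K + |Real.log ‖v‖| := by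
    intro v hv
    filter_upwards [eventually_ge_atTop 1] with n hn
    have hn1 : (1:ℝ) ≤ n := by exact_mod_cast hn
    rw [abs_div, Nat.abs_cast, div_le_iff₀ (by linarith)]
    have h3 := hlog n v hv
    have h4 : |Real.log ‖A n v‖| ≤ n * Real.log K + |Real.log ‖v‖| := by
      have := abs_sub_abs_le_abs_sub (Real.log ‖A n v‖) (Real.log ‖v‖)
      linarith
    nlinarith [abs_nonneg (Real.log ‖v‖)]
  refine ⟨E, hE, ?_, ?_⟩
  · intro v hv hv0
    apply le_of_forall_pos_le_add
    intro ε hε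
    set b := max (C / 2) (C - ε / 2) with hb
    have hb0 : 0 < b := lt_max_of_lt_left (by linarith)
    have hbC : b < C := max_lt (by linarith) (by linarith)
    have hbε : C - ε / 2 ≤ b := le_max_right _ _
    obtain ⟨R, hR, hev⟩ := h1 v hv hv0 b hb0 hbC
    refine limsup_le_of_le ?_ ?_
    · refine IsBoundedUnder.isCoboundedUnder_le ⟨-(Real.log K + |Real.log ‖v‖|), ?_⟩
      rw [eventually_map]
      filter_upwards [hbd v hv0] with n hn
      exact (abs_le.1 hn).1
    · have hsm := (tendsto_const_div (Real.log R)).eventually_le_const (u := ε / 2) (by linarith)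
      filter_upwards [hev, hsm, eventually_ge_atTop 1] with n h3 h4 hn
      have hn1 : (1:ℝ) ≤ n := by exact_mod_cast hn
      have hn0 : (0:ℝ) < n := by linarith
      have hpos := norm_pos_iff.2 (hne n v hv0)
      have h5 := Real.log_le_log hpos h3
      rw [Real.log_mul hR.ne' (Real.exp_pos _).ne', Real.log_exp] at h5
      rw [div_le_iff₀ hn0] at h4 ⊢
      nlinarith
  · intro v hv
    have hv0 : v ≠ 0 := by rintro rfl; exact hv (zero_mem _)
    apply le_of_forall_pos_le_add
    intro ε hε
    rw [← sub_le_iff_le_add]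
    set b := max (C / 2) (C - ε / 2) with hb
    have hb0 : 0 < b := lt_max_of_lt_left (by linarith)
    have hbC : b < C := max_lt (by linarith) (by linarith)
    have hbε : C - ε / 2 ≤ b := le_max_right _ _
    obtain ⟨R, hR, hev⟩ := h2 v hv b hb0 hbC
    refine le_liminf_of_le ?_ ?_
    · refine IsBoundedUnder.isCoboundedUnder_ge ⟨(Real.log K + |Real.log ‖v‖|), ?_⟩
      rw [eventually_map]
      filter_upwards [hbd v hv0] with n hn
      exact (abs_le.1 hn).2
    · have hsm := (tendsto_const_div (Real.log R)).eventually_le_const (u := ε / 2) (by linarith)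
      filter_upwards [hev, hsm, eventually_ge_atTop 1] with n h3 h4 hn
      have hn1 : (1:ℝ) ≤ n := by exact_mod_cast hn
      have hn0 : (0:ℝ) < n := by linarith
      have hpos := norm_pos_iff.2 (hne n v hv0)
      have h5 := Real.log_le_log (Real.exp_pos _) h3
      rw [Real.log_mul hR.ne' hpos.ne', Real.log_exp] at h5
      rw [div_le_iff₀ hn0] at h4
      rw [le_div_iff₀ hn0]
      nlinarith


lemma interp (g : ℕ → ℝ) (B : ℝ) (hB : ∀ j, |g (j + 1) - g j| ≤ B)
    (hs : Tendsto (fun m : ℕ => g (m ^ 2) / ((m : ℝ) ^ 2)) atTop (𝓝 0)) :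
    Tendsto (fun j : ℕ => g j / (j : ℝ)) atTop (𝓝 0) := by
  have hB0 : 0 ≤ B := (abs_nonneg _).trans (hB 0)
  have hdiff : ∀ i j : ℕ, |g (i + j) - g i| ≤ j * B := by
    intro i j
    induction j with
    | zero => simp
    | succ j ih =>
      have h1 := hB (i + j)
      have h2 := abs_add_le (g (i + j + 1) - g (i + j)) (g (i + j) - g i)
      rw [sub_add_sub_cancel] at h2
      rw [← add_assoc]
      push_cast
      linarith
  have hh : Tendsto (fun m : ℕ => |g (m ^ 2) / ((m : ℝ) ^ 2)| + 2 * B / (m : ℝ)) atTop (𝓝 0) := by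
    have := hs.abs.add (tendsto_const_div (2 * B))
    simpa using this
  have hsq : Tendsto Nat.sqrt atTop atTop := by
    rw [tendsto_atTop]
    intro b
    filter_upwards [eventually_ge_atTop (b * b)] with n hn
    exact Nat.le_sqrt.2 hn
  refine squeeze_zero_norm' ?_ (hh.comp hsq)
  filter_upwards [eventually_ge_atTop 1] with j hj
  simp only [Function.comp]
  set s := Nat.sqrt j with hsdef
  have h1 : s * s ≤ j := Nat.sqrt_le j
  have h2 : j ≤ s * s + s + s := Nat.sqrt_le_add j
  have hs1 : 1 ≤ s := Nat.le_sqrt.2 (by simpa using hj)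
  have hs1' : (1:ℝ) ≤ s := by exact_mod_cast hs1
  have hj' : (1:ℝ) ≤ j := by exact_mod_cast hj
  have h1' : (s:ℝ) ^ 2 ≤ j := by rw [sq]; exact_mod_cast h1
  obtain ⟨r, hr⟩ := Nat.exists_eq_add_of_le h1
  have hr2 : (r:ℝ) ≤ 2 * s := by
    have : r ≤ 2 * s := by omega
    exact_mod_cast this
  have h3 := hdiff (s * s) r
  rw [← hr, ← sq] at h3
  have h4 : |g j| ≤ |g (s ^ 2)| + 2 * s * B := by
    have := abs_sub_abs_le_abs_sub (g j) (g (s ^ 2))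
    nlinarith
  rw [Real.norm_eq_abs, abs_div, abs_div, Nat.abs_cast, abs_of_nonneg (sq_nonneg (s:ℝ))]
  calc |g j| / j ≤ (|g (s ^ 2)| + 2 * s * B) / (s:ℝ) ^ 2 := by
        gcongr
    _ = _ := by field_simp

open Classical in
/-- preimages as a finset -/
def pre (n : ℕ) (z : T2) : Finset T2 :=
  if h : (f.toFun^[n] ⁻¹' {z}).Finite then h.toFinset else ∅

lemma mem_pre {n : ℕ} {z : T2} (h : (f.toFun^[n] ⁻¹' {z}).Finite) (y : T2) :
    y ∈ pre f n z ↔ f.toFun^[n] y = z := by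
  simp [pre, h]

lemma bw_iter {x : T2} (ω : Bw f x) (n m : ℕ) : f.toFun^[m] (ω.1 (n + m)) = ω.1 n := by
  induction m with
  | zero => rfl
  | succ m ih => rw [Function.iterate_succ_apply, ← add_assoc, ω.2.2, ih]

lemma bw_iter0 {x : T2} (ω : Bw f x) (n : ℕ) : f.toFun^[n] (ω.1 n) = x := by
  have := bw_iter f ω 0 n
  rw [zero_add] at this
  rw [this, ω.2.1]

lemma meas_cyl {x : T2} (n : ℕ) (z : T2) : MeasurableSet {ω : Bw f x | ω.1 n = z} := by
  have : Measurable (fun ω : Bw f x => ω.1 n) := (measurable_pi_apply n).comp measurable_subtype_coe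
  exact this (measurableSet_singleton z)

lemma meas_union {x : T2} {p : Measure (Bw f x)} (hp : IsBernoulliBw f x p) (n : ℕ)
    (s : Finset T2) (hs : ∀ z ∈ s, f.toFun^[n] z = x) :
    p (⋃ z ∈ s, {ω : Bw f x | ω.1 n = z}) = s.card * ((f.deg : ℝ≥0∞) ^ n)⁻¹ := by
  rw [measure_biUnion_finset]
  · rw [Finset.sum_congr rfl (fun z hz => hp.2 n z (hs z hz))]
    simp
  · intro a _ b _ hab
    apply Set.disjoint_left.2
    intro ω h1 h2
    exact hab (h1.symm.trans h2)
  · intro z _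
    exact meas_cyl f n z

lemma card_conv {d : ℕ} (hd : 2 ≤ d) (a n k : ℕ)
    (h : (a : ℝ≥0∞) * ((d : ℝ≥0∞) ^ (k + n))⁻¹ = ((d : ℝ≥0∞) ^ k)⁻¹) : a = d ^ n := by
  have h0 : ∀ m, ((d : ℝ≥0∞) ^ m) ≠ 0 := fun m => pow_ne_zero _ (by norm_cast; omega)
  have ht : ∀ m, ((d : ℝ≥0∞) ^ m) ≠ ⊤ := fun m => ENNReal.pow_ne_top (ENNReal.natCast_ne_top d)
  have h2 := congrArg (· * ((d : ℝ≥0∞) ^ (k + n))) h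
  simp only [mul_assoc, ENNReal.inv_mul_cancel (h0 _) (ht _), mul_one] at h2
  rw [pow_add, ← mul_assoc, ENNReal.inv_mul_cancel (h0 _) (ht _), one_mul] at h2
  exact_mod_cast h2

lemma finite_pre0 {x : T2} {p : Measure (Bw f x)} (hp : IsBernoulliBw f x p) (hdeg : 2 ≤ f.deg)
    (n : ℕ) : (f.toFun^[n] ⁻¹' {x}).Finite := by
  by_contra hinf
  obtain ⟨s, hs, hcard⟩ := Set.Infinite.exists_subset_card_eq hinf (f.deg ^ n + 1)
  have h1 := meas_union f hp n s (fun z hz => hs hz)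
  have := hp.1
  have h2 : p (⋃ z ∈ s, {ω : Bw f x | ω.1 n = z}) ≤ 1 := prob_le_one
  rw [h1, hcard, ← div_eq_mul_inv, ENNReal.div_le_iff] at h2
  · rw [one_mul] at h2
    have h3 : f.deg ^ n + 1 ≤ f.deg ^ n := by exact_mod_cast h2
    omega
  · exact pow_ne_zero _ (by norm_cast; omega)
  · exact ENNReal.pow_ne_top (ENNReal.natCast_ne_top _)

lemma finite_pre {x : T2} {p : Measure (Bw f x)} (hp : IsBernoulliBw f x p) (hdeg : 2 ≤ f.deg)
    (k n : ℕ) (z : T2) (hz : f.toFun^[k] z = x) : (f.toFun^[n] ⁻¹' {z}).Finite := by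
  refine (finite_pre0 f hp hdeg (k + n)).subset ?_
  intro y hy
  change f.toFun^[k + n] y = x
  rw [Function.iterate_add_apply, hy, hz]

lemma card_pre {x : T2} {p : Measure (Bw f x)} (hp : IsBernoulliBw f x p) (hdeg : 2 ≤ f.deg)
    (k n : ℕ) (z : T2) (hz : f.toFun^[k] z = x) : (pre f n z).card = f.deg ^ n := by
  have hm := fun y => mem_pre f (finite_pre f hp hdeg k n z hz) y
  have h1 := meas_union f hp (k + n) (pre f n z) (fun y hy => by
    rw [Function.iterate_add_apply, (hm y).1 hy, hz])
  have h2 : (⋃ y ∈ pre f n z, {ω : Bw f x | ω.1 (k + n) = y}) = {ω | ω.1 k = z} := by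
    ext ω
    simp only [Set.mem_iUnion, Set.mem_ofPred_eq, exists_prop, exists_eq_right']
    rw [hm, bw_iter]
  rw [h2, hp.2 k z hz] at h1
  exact card_conv hdeg _ n k h1.symm

lemma lint {x : T2} {p : Measure (Bw f x)} (hp : IsBernoulliBw f x p) (hdeg : 2 ≤ f.deg)
    (n : ℕ) (h : T2 → ℝ≥0∞) : Measurable (fun ω : Bw f x => h (ω.1 n)) ∧
    ∫⁻ ω, h (ω.1 n) ∂p = (∑ z ∈ pre f n x, h z) * ((f.deg : ℝ≥0∞) ^ n)⁻¹ := by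
  have hm := fun y => mem_pre f (finite_pre0 f hp hdeg n) y
  have heq : (fun ω : Bw f x => h (ω.1 n)) =
      fun ω => ∑ z ∈ pre f n x, ({ω : Bw f x | ω.1 n = z}).indicator (fun _ => h z) ω := by
    ext ω
    rw [Finset.sum_eq_single (ω.1 n)]
    · simp
    · intro b _ hb
      simp [Ne.symm hb]
    · intro hn
      exact absurd ((hm _).2 (bw_iter0 f ω n)) hn
  have hmeas : ∀ z, Measurable (({ω : Bw f x | ω.1 n = z}).indicator (fun _ => h z)) :=
    fun z => measurable_const.indicator (meas_cyl f n z)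
  rw [heq]
  refine ⟨Finset.measurable_fun_sum _ (fun z _ => hmeas z), ?_⟩
  rw [lintegral_finsetSum _ (fun z _ => hmeas z), Finset.sum_mul]
  refine Finset.sum_congr rfl (fun z hz => ?_)
  rw [lintegral_indicator_const (meas_cyl f n z), hp.2 n z ((hm z).1 hz)]

lemma sum_pre {x : T2} {p : Measure (Bw f x)} (hp : IsBernoulliBw f x p) (hdeg : 2 ≤ f.deg)
    (n m : ℕ) (φ : T2 → ℝ) :
    ∑ y ∈ pre f (n + m) x, φ y = ∑ z ∈ pre f n x, ∑ y ∈ pre f m z, φ y := by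
  classical
  have hm := fun n y => mem_pre f (finite_pre0 f hp hdeg n) y
  rw [← Finset.sum_fiberwise_of_maps_to (t := pre f n x) (g := fun y => f.toFun^[m] y)]
  · refine Finset.sum_congr rfl (fun z hz => ?_)
    have hz' := (hm n z).1 hz
    refine Finset.sum_congr ?_ (fun _ _ => rfl)
    ext y
    rw [Finset.mem_filter, hm, mem_pre f (finite_pre f hp hdeg n m z hz'),
      Function.iterate_add_apply]
    constructor
    · exact fun h => h.2
    · intro h; rw [h]; exact ⟨hz', rfl⟩
  · intro y hy
    rw [hm] at hy ⊢
    rwa [Function.iterate_add_apply] at hy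

lemma second_moment {x : T2} {p : Measure (Bw f x)} (hp : IsBernoulliBw f x p)
    (hdeg : 2 ≤ f.deg) (N : ℕ) (G : ℕ → T2 → ℝ) (B : ℝ) (hG0 : ∀ z, G 0 z = 0)
    (hB : ∀ j y, f.toFun^[(j + 1) * N] y = x → |G (j + 1) y - G j (f.toFun^[N] y)| ≤ B)
    (hmart : ∀ j z, f.toFun^[j * N] z = x → ∑ y ∈ pre f N z, (G (j + 1) y - G j z) = 0) (j : ℕ) :
    ∑ z ∈ pre f (j * N) x, G j z ^ 2 ≤ j * B ^ 2 * (f.deg : ℝ) ^ (j * N) := by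
  induction j with
  | zero => simp [hG0]
  | succ j ih =>
    have hj : (j + 1) * N = j * N + N := by ring
    have hm := fun n y => mem_pre f (finite_pre0 f hp hdeg n) y
    rw [hj, sum_pre f hp hdeg]
    have key : ∀ z ∈ pre f (j * N) x, ∑ y ∈ pre f N z, G (j + 1) y ^ 2 ≤
        (f.deg : ℝ) ^ N * (G j z ^ 2 + B ^ 2) := by
      intro z hz
      have hz' := (hm _ z).1 hz
      have hmz := fun y => mem_pre f (finite_pre f hp hdeg (j * N) N z hz') y
      have hc := card_pre f hp hdeg (j * N) N z hz'
      calc ∑ y ∈ pre f N z, G (j + 1) y ^ 2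
          ≤ ∑ y ∈ pre f N z, (G j z ^ 2 + B ^ 2 + 2 * G j z * (G (j + 1) y - G j z)) := by
            refine Finset.sum_le_sum (fun y hy => ?_)
            have hy' := (hmz y).1 hy
            have h1 := hB j y (by rw [hj, Function.iterate_add_apply, hy', hz'])
            rw [hy'] at h1
            have h2 : (G (j + 1) y - G j z) ^ 2 ≤ B ^ 2 := sq_le_sq' (abs_le.1 h1).1 (abs_le.1 h1).2
            nlinarith
        _ = _ := by
            rw [Finset.sum_add_distrib, ← Finset.mul_sum, hmart j z hz', Finset.sum_const, hc]
            simp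
            ring
    have hcx := card_pre f hp hdeg 0 (j * N) x rfl
    calc _ ≤ ∑ z ∈ pre f (j * N) x, (f.deg : ℝ) ^ N * (G j z ^ 2 + B ^ 2) := Finset.sum_le_sum key
      _ = (f.deg : ℝ) ^ N * (∑ z ∈ pre f (j * N) x, G j z ^ 2 + (f.deg : ℝ) ^ (j * N) * B ^ 2) := by
          rw [← Finset.mul_sum, Finset.sum_add_distrib, Finset.sum_const, hcx]; simp
      _ ≤ (f.deg : ℝ) ^ N * (j * B ^ 2 * (f.deg : ℝ) ^ (j * N) + (f.deg : ℝ) ^ (j * N) * B ^ 2) := by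
          gcongr
      _ = _ := by push_cast; rw [pow_add]; ring

lemma slln {x : T2} {p : Measure (Bw f x)} (hp : IsBernoulliBw f x p)
    (hdeg : 2 ≤ f.deg) (N : ℕ) (G : ℕ → T2 → ℝ) (B : ℝ) (hG0 : ∀ z, G 0 z = 0)
    (hB : ∀ j y, f.toFun^[(j + 1) * N] y = x → |G (j + 1) y - G j (f.toFun^[N] y)| ≤ B)
    (hmart : ∀ j z, f.toFun^[j * N] z = x → ∑ y ∈ pre f N z, (G (j + 1) y - G j z) = 0) :
    ∀ᵐ ω ∂p, Tendsto (fun j : ℕ => G j (ω.1 (j * N)) / (j : ℝ)) atTop (𝓝 0) := by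
  have hsm := second_moment f hp hdeg N G B hG0 hB hmart
  have hd0 : (0:ℝ) < f.deg := by exact_mod_cast (by omega : 0 < f.deg)
  set H : ℕ → T2 → ℝ≥0∞ := fun m z => ENNReal.ofReal ((G (m ^ 2) z / ((m:ℝ) ^ 2)) ^ 2) with hH
  have hintg : ∀ m : ℕ, ∫⁻ ω, H m (ω.1 (m ^ 2 * N)) ∂p ≤ ENNReal.ofReal (B ^ 2 / (m:ℝ) ^ 2) := by
    intro m
    rw [(lint f hp hdeg (m ^ 2 * N) (H m)).2]
    simp only [hH]
    rw [← ENNReal.ofReal_sum_of_nonneg (fun _ _ => sq_nonneg _)]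
    have : ((f.deg : ℝ≥0∞) ^ (m ^ 2 * N))⁻¹ = ENNReal.ofReal (((f.deg : ℝ) ^ (m ^ 2 * N))⁻¹) := by
      rw [ENNReal.ofReal_inv_of_pos (by positivity), ENNReal.ofReal_pow hd0.le,
        ENNReal.ofReal_natCast]
    rw [this, ← ENNReal.ofReal_mul (Finset.sum_nonneg (fun _ _ => sq_nonneg _))]
    apply ENNReal.ofReal_le_ofReal
    rcases Nat.eq_zero_or_pos m with rfl | hm
    · simp
    have hm' : (0:ℝ) < m := by exact_mod_cast hm
    have h1 := hsm (m ^ 2)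
    simp_rw [div_pow]
    rw [← Finset.sum_div, ← div_eq_mul_inv, div_le_iff₀ (by positivity), div_le_iff₀ (by positivity)]
    refine h1.trans (le_of_eq ?_)
    push_cast
    field_simp
  have htot : ∫⁻ ω, ∑' m, H m (ω.1 (m ^ 2 * N)) ∂p ≠ ⊤ := by
    rw [lintegral_tsum (fun m => (lint f hp hdeg (m ^ 2 * N) (H m)).1.aemeasurable)]
    refine ne_top_of_le_ne_top ?_ (ENNReal.tsum_le_tsum hintg)
    have hsum : Summable (fun m : ℕ => B ^ 2 / (m:ℝ) ^ 2) := by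
      simp_rw [div_eq_mul_inv]
      exact (Real.summable_nat_pow_inv.2 (by norm_num)).mul_left _
    rw [← ENNReal.ofReal_tsum_of_nonneg (fun m => by positivity) hsum]
    exact ENNReal.ofReal_ne_top
  have hmeas : Measurable (fun ω : Bw f x => ∑' m, H m (ω.1 (m ^ 2 * N))) :=
    Measurable.tsum (fun m => (lint f hp hdeg (m ^ 2 * N) (H m)).1)
  filter_upwards [ae_lt_top hmeas htot] with ω hω
  apply interp (fun j => G j (ω.1 (j * N))) B
  · intro j
    have h1 := bw_iter f ω (j * N) N
    have h2 := hB j (ω.1 ((j + 1) * N)) (bw_iter0 f ω _)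
    rwa [show (j + 1) * N = j * N + N by ring, h1, ← show (j + 1) * N = j * N + N by ring] at h2
  · have h1 := ENNReal.tendsto_atTop_zero_of_tsum_ne_top hω.ne
    have h2 := (ENNReal.tendsto_toReal ENNReal.zero_ne_top).comp h1
    have h3 : Tendsto (fun m : ℕ => (G (m ^ 2) (ω.1 (m ^ 2 * N)) / ((m:ℝ) ^ 2)) ^ 2) atTop (𝓝 0) := by
      refine h2.congr (fun m => ?_)
      simp only [Function.comp, hH]
      exact ENNReal.toReal_ofReal (sq_nonneg _)
    have h4 := h3.sqrt
    simp only [Real.sqrt_sq_eq_abs, Real.sqrt_zero] at h4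
    exact (tendsto_zero_iff_abs_tendsto_zero _).2 h4


lemma growth_det (L W : ℕ → ℝ) (N : ℕ) (hN : 1 ≤ N) (c B : ℝ) (hc : 0 < c)
    (hL : ∀ n m, |L (n + m) - L n| ≤ m * B)
    (hstep : ∀ j, c * N + (W (j + 1) - W j) ≤ L ((j + 1) * N) - L (j * N))
    (hW : Tendsto (fun j : ℕ => W j / (j : ℝ)) atTop (𝓝 0)) :
    ∀ δ > 0, ∃ n0 : ℕ, ∀ n ≥ n0, ∀ k ≥ n, c * ((k : ℝ) - n) - δ * k ≤ L k - L n := by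
  intro δ hδ
  have hmono : Monotone (fun j : ℕ => L (j * N) - c * N * j - W j) := by
    refine monotone_nat_of_le_succ (fun j => ?_)
    have := hstep j
    push_cast
    linarith
  have hB0 : 0 ≤ B := by
    have := (abs_nonneg _).trans (hL 0 1)
    simpa using this
  have hN' : (1:ℝ) ≤ N := by exact_mod_cast hN
  have h1 := hW.abs
  rw [abs_zero] at h1
  obtain ⟨i0, hi0⟩ := eventually_atTop.1 (h1.eventually_le_const (u := δ / 4) (by linarith))
  obtain ⟨k0, hk0⟩ := exists_nat_ge ((c * N + 2 * (N * B)) / (δ / 2))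
  rw [div_le_iff₀ (by linarith)] at hk0
  refine ⟨max ((i0 + 1) * N) k0, fun n hn k hk => ?_⟩
  have hn1 : (i0 + 1) * N ≤ n := le_trans (le_max_left _ _) hn
  have hn2 : k0 ≤ n := le_trans (le_max_right _ _) hn
  have hWb : ∀ m, (i0 + 1) * N ≤ m → m ≤ k → |W (m / N)| ≤ δ / 4 * k := by
    intro m hm hmk
    have h2 : i0 + 1 ≤ m / N := (Nat.le_div_iff_mul_le (by omega)).2 hm
    have h3 := hi0 (m / N) (by omega)
    have h4 : (0:ℝ) < ((m / N : ℕ) : ℝ) := by exact_mod_cast (by omega : 0 < m / N)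
    rw [abs_div, Nat.abs_cast, div_le_iff₀ h4] at h3
    have h5 : ((m / N : ℕ) : ℝ) ≤ k := by exact_mod_cast (Nat.div_le_self m N).trans hmk
    nlinarith
  have hLb : ∀ m, |L m - L (m / N * N)| ≤ N * B := by
    intro m
    have h2 := hL (m / N * N) (m % N)
    rw [Nat.div_add_mod'] at h2
    have h3 : ((m % N : ℕ) : ℝ) ≤ N := by exact_mod_cast (Nat.mod_lt m (by omega)).le
    nlinarith
  have e1 := abs_le.1 (hWb n hn1 hk)
  have e2 := abs_le.1 (hWb k (hn1.trans hk) le_rfl)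
  have e3 := abs_le.1 (hLb n)
  have e4 := abs_le.1 (hLb k)
  have e5 := hmono (Nat.div_le_div_right (c := N) hk)
  simp only at e5
  have e6 : ((n / N : ℕ) : ℝ) * N ≤ n := by exact_mod_cast Nat.div_mul_le_self n N
  have e7 : (k : ℝ) ≤ ((k / N : ℕ) : ℝ) * N + N := by
    have h2 := Nat.div_add_mod' k N
    have h3 := Nat.mod_lt k (show N > 0 by omega)
    have : k ≤ k / N * N + N := by omega
    exact_mod_cast this
  have e8 : (k0 : ℝ) ≤ k := by exact_mod_cast hn2.trans hk
  have e9 : (k0 : ℝ) * (δ / 2) ≤ k * (δ / 2) := by gcongr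
  have e10 : c * ((k : ℝ) - n - N) ≤ c * (((k / N : ℕ) : ℝ) * N - ((n / N : ℕ) : ℝ) * N) := by
    exact mul_le_mul_of_nonneg_left (by linarith) hc.le
  linarith [e1.1, e1.2, e2.1, e2.2, e3.1, e3.2, e4.1, e4.2]

lemma exists_N (c : ℝ) (hc : 0 < c) (hcC : c < f.C) :
    ∃ N : ℕ, 1 ≤ N ∧ ∀ (z : T2) (v : V2), ‖v‖ = 1 → c * N ≤ f.I z v N := by
  have h1 : ∃ a, c < a ∧ ∀ᶠ n : ℕ in atTop, a ≤ f.unifInf n / n := by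
    unfold TorusMap.C at hcC
    rw [Filter.liminf_eq] at hcC
    by_cases hne : {a | ∀ᶠ n : ℕ in atTop, a ≤ f.unifInf n / n}.Nonempty
    · obtain ⟨a, ha, hca⟩ := exists_lt_of_lt_csSup hne hcC
      exact ⟨a, hca, ha⟩
    · rw [Set.not_nonempty_iff_eq_empty.1 hne, Real.sSup_empty] at hcC
      linarith
  obtain ⟨a, hca, ha⟩ := h1
  obtain ⟨N, hN, hN1⟩ := (ha.and (eventually_ge_atTop 1)).exists
  refine ⟨N, hN1, fun z v hv => ?_⟩
  have hN' : (0:ℝ) < N := by exact_mod_cast (by omega : 0 < N)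
  rw [le_div_iff₀ hN'] at hN
  have hpos : 0 < f.unifInf N := lt_of_lt_of_le (mul_pos (hc.trans hca) hN') hN
  have hbdd : BddBelow (Set.range (fun xv : T2 × Metric.sphere (0 : V2) 1 =>
      f.I xv.1 (xv.2 : V2) N)) := by
    by_contra hcon
    have : f.unifInf N = 0 := Real.sInf_of_not_bddBelow hcon
    linarith
  have h2 : f.unifInf N ≤ f.I z v N :=
    ciInf_le hbdd (⟨z, ⟨v, by simpa using hv⟩⟩ : T2 × Metric.sphere (0 : V2) 1)
  nlinarith

/-- log norm along the orbit -/
def ell (n : ℕ) (z : T2) : ℝ := Real.log ‖f.Dninv n z e0‖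

/-- the conditional drift -/
def kap (N j : ℕ) (z : T2) : ℝ :=
  ((f.deg : ℝ) ^ N)⁻¹ * ∑ y ∈ pre f N z, (ell f ((j + 1) * N) y - ell f (j * N) z)

/-- the martingale -/
def GG (N : ℕ) : ℕ → T2 → ℝ
  | 0, _ => 0
  | j + 1, y => GG N j (f.toFun^[N] y) +
      (ell f ((j + 1) * N) y - ell f (j * N) (f.toFun^[N] y) - kap f N j (f.toFun^[N] y))

lemma e0_ne : e0 ≠ 0 := by
  intro h
  have := congrArg (fun v : V2 => v 0) h
  simp [e0] at this

lemma ell_diff {K : ℝ} (hK1 : 1 ≤ K) (hK : ∀ z, ‖f.D z‖ ≤ K ∧ ‖Ring.inverse (f.D z)‖ ≤ K)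
    (n m : ℕ) (y : T2) : |ell f (n + m) y - ell f n (f.toFun^[m] y)| ≤ m * Real.log K := by
  unfold ell
  rw [Dninv_add]
  exact (log_bounds f hK1 hK m y _ (log_bounds f hK1 hK n _ _ e0_ne).1).2

lemma growth {x : T2} {p : Measure (Bw f x)} (hp : IsBernoulliBw f x p) (hdeg : 2 ≤ f.deg)
    (c : ℝ) (hc : 0 < c) (hcC : c < f.C) :
    ∀ᵐ ω ∂p, ∀ δ > 0, ∃ n0 : ℕ, ∀ n ≥ n0, ∀ k ≥ n, c * ((k : ℝ) - n) - δ * k ≤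
      ell f k (ω.1 k) - ell f n (ω.1 n) := by
  obtain ⟨K, hK1, hK⟩ := exists_bound f
  obtain ⟨N, hN, hI⟩ := exists_N f c hc hcC
  have hd0 : (0:ℝ) < (f.deg : ℝ) ^ N := by
    have : (0:ℝ) < f.deg := by exact_mod_cast (by omega : 0 < f.deg)
    positivity
  have hsucc : ∀ j, (j + 1) * N = j * N + N := fun j => by ring
  have hdiff : ∀ j z y, f.toFun^[N] y = z →
      |ell f ((j + 1) * N) y - ell f (j * N) z| ≤ N * Real.log K := by
    intro j z y hy
    rw [hsucc, ← hy]
    exact ell_diff f hK1 hK _ _ _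
  have hkap_abs : ∀ j z, f.toFun^[j * N] z = x → |kap f N j z| ≤ N * Real.log K := by
    intro j z hz
    have hmz := fun y => mem_pre f (finite_pre f hp hdeg (j * N) N z hz) y
    have hcz := card_pre f hp hdeg (j * N) N z hz
    unfold kap
    rw [abs_mul, abs_of_pos (inv_pos.2 hd0), inv_mul_le_iff₀ hd0]
    refine (Finset.abs_sum_le_sum_abs _ _).trans ?_
    refine (Finset.sum_le_card_nsmul _ _ _ (fun y hy => hdiff j z y ((hmz y).1 hy))).trans ?_
    rw [hcz]; simp
  have hkap_low : ∀ j z, f.toFun^[j * N] z = x → c * N ≤ kap f N j z := by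
    intro j z hz
    have hfin := finite_pre f hp hdeg (j * N) N z hz
    have hmz := fun y => mem_pre f hfin y
    set u := f.Dninv (j * N) z e0 with hu
    have hu0 : u ≠ 0 := (log_bounds f hK1 hK (j * N) z _ e0_ne).1
    have hun : 0 < ‖u‖ := norm_pos_iff.2 hu0
    have h1 := hI z (‖u‖⁻¹ • u) (by rw [norm_smul, norm_inv, norm_norm]; field_simp)
    refine h1.trans (le_of_eq ?_)
    unfold TorusMap.I kap
    congr 1
    rw [finsum_mem_eq_finite_toFinset_sum _ hfin]
    have : hfin.toFinset = pre f N z := by simp [pre, hfin]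
    rw [this]
    refine Finset.sum_congr rfl (fun y hy => ?_)
    have hy' := (hmz y).1 hy
    have hne : 0 < ‖f.Dninv N y u‖ := norm_pos_iff.2 (log_bounds f hK1 hK N y u hu0).1
    rw [map_smul, norm_smul, norm_inv, norm_norm, Real.log_mul (inv_pos.2 hun).ne' hne.ne',
      Real.log_inv]
    unfold ell
    rw [hsucc, Dninv_add, hy', ← hu]
    ring
  have hs := slln f hp hdeg N (GG f N) (2 * (N * Real.log K)) (fun _ => rfl)
    (by
      intro j y hy
      have hz : f.toFun^[j * N] (f.toFun^[N] y) = x := by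
        rw [← Function.iterate_add_apply, ← hsucc, hy]
      have h1 := abs_le.1 (hdiff j _ y rfl)
      have h2 := abs_le.1 (hkap_abs j _ hz)
      simp only [GG]
      rw [add_sub_cancel_left, abs_le]
      constructor <;> linarith [h1.1, h1.2, h2.1, h2.2])
    (by
      intro j z hz
      have hmz := fun y => mem_pre f (finite_pre f hp hdeg (j * N) N z hz) y
      have hcz := card_pre f hp hdeg (j * N) N z hz
      have : ∀ y ∈ pre f N z, GG f N (j + 1) y - GG f N j z =
          (ell f ((j + 1) * N) y - ell f (j * N) z) - kap f N j z := by
        intro y hy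
        simp only [GG]
        rw [(hmz y).1 hy]; ring
      rw [Finset.sum_congr rfl this, Finset.sum_sub_distrib, Finset.sum_const, hcz]
      unfold kap
      simp only [nsmul_eq_mul]
      push_cast
      rw [mul_inv_cancel_left₀ hd0.ne', sub_self])
  filter_upwards [hs] with ω hω
  refine growth_det (fun n => ell f n (ω.1 n)) (fun j => GG f N j (ω.1 (j * N))) N hN c
    (Real.log K) hc ?_ ?_ hω
  · intro n m
    have h1 := ell_diff f hK1 hK n m (ω.1 (n + m))
    rwa [bw_iter] at h1
  · intro j
    have h1 : f.toFun^[N] (ω.1 ((j + 1) * N)) = ω.1 (j * N) := by rw [hsucc, bw_iter]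
    have h2 := hkap_low j (ω.1 (j * N)) (bw_iter0 f ω _)
    simp only [GG, h1]
    linarith

end UD

/-- Let `f` be a `C²` local diffeomorphism of `𝕋²` of degree `d ≥ 2` with
`C(f) > 0` and `inf_x |det Df_x| > 1`. Then for every `x ∈ 𝕋²`, for `p_x`-almost every
backward orbit `x̂ = (x₀,x₁,…)` of `x`, there is a one-dimensional subspace `Eᵘ(x̂) ⊆ ℝ²`
such that every nonzero `v ∈ Eᵘ(x̂)` satisfies
`limsup_n (1/n) log‖(Dfⁿ_{xₙ})⁻¹ v‖ ≤ -C(f)`, while every `v ∈ ℝ² ∖ Eᵘ(x̂)` satisfies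
`liminf_n (1/n) log‖(Dfⁿ_{xₙ})⁻¹ v‖ ≥ C(f)`. -/
theorem unstable_direction_on_backward_orbits (f : TorusMap 2) (hdeg : 2 ≤ f.deg)
    (hC : 0 < f.C) (hdet : 1 < ⨅ x : T2, |f.detD x|) :
    ∀ x : T2, ∀ p : Measure (Bw f x), IsBernoulliBw f x p →
      ∀ᵐ ω ∂p, ∃ E : Submodule ℝ V2, Module.finrank ℝ E = 1 ∧
        (∀ v ∈ E, v ≠ 0 →
          Filter.limsup (fun n : ℕ => Real.log ‖f.Dninv n (ω.1 n) v‖ / n) Filter.atTop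
            ≤ -f.C) ∧
        (∀ v : V2, v ∉ E →
          f.C ≤
            Filter.liminf (fun n : ℕ => Real.log ‖f.Dninv n (ω.1 n) v‖ / n) Filter.atTop) := by
  intro x p hp
  obtain ⟨K, hK1, hK⟩ := UD.exists_bound f
  have hall : ∀ᵐ ω ∂p, ∀ i : ℕ, ∀ δ > 0, ∃ n0 : ℕ, ∀ n ≥ n0, ∀ k ≥ n,
      (f.C - f.C / ((i : ℝ) + 2)) * ((k : ℝ) - n) - δ * k ≤
        UD.ell f k (ω.1 k) - UD.ell f n (ω.1 n) := by
    rw [ae_all_iff]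
    intro i
    have hi : (0:ℝ) ≤ i := Nat.cast_nonneg i
    have h1 : 0 < f.C / ((i : ℝ) + 2) := by positivity
    have h2 : f.C / ((i : ℝ) + 2) < f.C := div_lt_self hC (by linarith)
    exact UD.growth f hp hdeg _ (by linarith) (by linarith)
  filter_upwards [hall] with ω hω
  have hrel : ∀ n u, f.Dninv (n + 1) (ω.1 (n + 1)) u =
      f.Dninv 1 (ω.1 (n + 1)) (f.Dninv n (ω.1 n) u) := by
    intro n u
    rw [UD.Dninv_add, UD.bw_iter]
  refine UD.core_lim (fun n => f.Dninv n (ω.1 n)) K f.C hK1 ?_ ?_ ?_ ?_ hC ?_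
  · intro n u
    rw [hrel]
    exact (UD.step_bounds f hK _ _).1
  · intro n u hu
    exact (UD.log_bounds f hK1 hK n _ u hu).1
  · intro n u hu
    exact (UD.log_bounds f hK1 hK n _ u hu).2
  · intro n
    induction n with
    | zero =>
      simp only [UD.Dninv_zero]
      simp [UD.area, UD.e0, UD.e1]
    | succ n ih =>
      rw [hrel, hrel]
      exact (UD.area_step f hdet _ _ _).trans ih
  · intro c hc hcC δ hδ
    obtain ⟨i, hi⟩ := exists_nat_ge (f.C / (f.C - c))
    rw [div_le_iff₀ (by linarith)] at hi
    have hi2 : f.C / ((i : ℝ) + 2) ≤ f.C - c := by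
      have : (0:ℝ) ≤ i := Nat.cast_nonneg i
      rw [div_le_iff₀ (by positivity)]
      nlinarith
    obtain ⟨n0, h0⟩ := hω i δ hδ
    refine ⟨n0, fun n hn k hk => ?_⟩
    have h1 := h0 n hn k hk
    have h2 : (n:ℝ) ≤ k := by exact_mod_cast hk
    unfold UD.ell at h1
    nlinarith

end
end
end

section
/- Let f be a C² local diffeomorphism of 𝕋² of degree d ≥ 2 with C(f) > 0 and inf_{x∈𝕋²} |det Df_x| > 1. Then every equidistributed f-invariant Borel probability measure μ is C(f)-hyperbolic: for μ-almost every x the limits χ⁺(x) = lim_n (1/n) log‖Dfⁿ_x‖ and χ⁻(x) = lim_n (1/n) log m(Dfⁿ_x) exist and satisfy χ⁻(x) ≤ −C(f) < C(f) ≤ χ⁺(x). -/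
open MeasureTheory Filter Topology Set
open scoped ENNReal NNReal

noncomputable section


open MeasureTheory Filter Topology Set
open scoped ENNReal NNReal

noncomputable section

set_option linter.unusedSectionVars false

section Kingman

variable {X : Type*}

lemma comb_bound (T : X → X) (a : ℕ → X → ℝ) (K : ℝ) (hK : 0 ≤ K)
    (hbd : ∀ n x, |a n x| ≤ n * K)
    (hsub : ∀ m n x, a (m + n) x ≤ a m x + a n (T^[m] x))
    (c : ℝ) (hc : -K ≤ c) (B : Set X) (N : ℕ) :
    ∀ (n : ℕ) (y : X),
      (∀ k, T^[k] y ∉ B → ∃ l : ℕ, 1 ≤ l ∧ l ≤ N ∧ a l (T^[k] y) ≤ l * c) →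
      a n y ≤ n * c + 2 * K * (birkhoffSum T (B.indicator fun _ => (1:ℝ)) n y + N) := by
  intro n
  have hS : ∀ n y, 0 ≤ birkhoffSum T (B.indicator fun _ => (1:ℝ)) n y := by
    intro n y
    refine Finset.sum_nonneg fun k _ => ?_
    exact Set.indicator_nonneg (fun _ _ => zero_le_one) _
  induction n using Nat.strong_induction_on with
  | _ n ih =>
    intro y hy
    by_cases hnN : n ≤ N
    · have h1 := (abs_le.1 (hbd n y)).2
      have h2 := hS n y
      have h3 : (n : ℝ) ≤ N := by exact_mod_cast hnN
      have h4 : (0:ℝ) ≤ n := n.cast_nonneg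
      have h5 : 0 ≤ K * birkhoffSum T (B.indicator fun _ => (1:ℝ)) n y := mul_nonneg hK h2
      have h6 : K * n ≤ K * N := mul_le_mul_of_nonneg_left h3 hK
      have h7 : 0 ≤ n * (c + K) := mul_nonneg h4 (by linarith)
      nlinarith
    · push Not at hnN
      by_cases hyB : y ∈ B
      · obtain ⟨m, rfl⟩ : ∃ m, n = 1 + m := ⟨n - 1, by omega⟩
        have h1 := hsub 1 m y
        have h2 := ih m (by omega) (T^[1] y) (by
          intro k hk
          rw [← Function.iterate_add_apply] at hk ⊢
          exact hy _ hk)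
        have h3 := (abs_le.1 (hbd 1 y)).2
        rw [birkhoffSum_add]
        have h4 : birkhoffSum T (B.indicator fun _ => (1:ℝ)) 1 y = 1 := by
          simp [birkhoffSum_one, hyB]
        rw [h4]
        push_cast at *
        nlinarith
      · obtain ⟨l, hl1, hlN, hl⟩ := hy 0 hyB
        obtain ⟨m, rfl⟩ : ∃ m, n = l + m := ⟨n - l, by omega⟩
        have h1 := hsub l m y
        have h2 := ih m (by omega) (T^[l] y) (by
          intro k hk
          rw [← Function.iterate_add_apply] at hk ⊢
          exact hy _ hk)
        rw [birkhoffSum_add]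
        have h3 := mul_nonneg hK (hS l y)
        simp only [Function.iterate_zero, id] at hl
        push_cast at *
        nlinarith

lemma div_abs_le {a : ℕ → ℝ} {K : ℝ} (hK : 0 ≤ K) (hbd : ∀ n, |a n| ≤ n * K) (n : ℕ) :
    |a n / n| ≤ K := by
  rcases Nat.eq_zero_or_pos n with rfl | hn
  · simpa using hK
  · have : (0:ℝ) < n := by exact_mod_cast hn
    rw [abs_div, abs_of_pos this, div_le_iff₀ this]
    linarith [hbd n]

lemma bddLe {u : ℕ → ℝ} {K : ℝ} (h : ∀ n, |u n| ≤ K) :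
    IsBoundedUnder (· ≤ ·) atTop u :=
  isBoundedUnder_of ⟨K, fun n => (abs_le.1 (h n)).2⟩

lemma bddGe {u : ℕ → ℝ} {K : ℝ} (h : ∀ n, |u n| ≤ K) :
    IsBoundedUnder (· ≥ ·) atTop u :=
  isBoundedUnder_of ⟨-K, fun n => (abs_le.1 (h n)).1⟩

lemma abs_liminf_le {u : ℕ → ℝ} {K : ℝ} (h : ∀ n, |u n| ≤ K) : |liminf u atTop| ≤ K := by
  rw [abs_le]
  constructor
  · exact le_liminf_of_le (bddLe h).isCoboundedUnder_ge
      (Eventually.of_forall fun n => (abs_le.1 (h n)).1)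
  · exact liminf_le_of_le (bddGe h)
      (fun b hb => by
        obtain ⟨n, hn⟩ := hb.exists
        exact hn.trans (abs_le.1 (h n)).2)

lemma abs_limsup_le {u : ℕ → ℝ} {K : ℝ} (h : ∀ n, |u n| ≤ K) : |limsup u atTop| ≤ K := by
  rw [abs_le]
  constructor
  · exact le_limsup_of_le (bddLe h)
      (fun b hb => by
        obtain ⟨n, hn⟩ := hb.exists
        exact (abs_le.1 (h n)).1.trans hn)
  · exact limsup_le_of_le (bddGe h).isCoboundedUnder_le
      (Eventually.of_forall fun n => (abs_le.1 (h n)).2)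

variable [MeasurableSpace X] {μ : Measure X} [IsProbabilityMeasure μ] {T : X → X}
  {a : ℕ → X → ℝ} {K : ℝ}

lemma integrable_bdd {φ : X → ℝ} (hm : Measurable φ) {K : ℝ} (h : ∀ x, |φ x| ≤ K) :
    Integrable φ μ :=
  Integrable.of_bound hm.aestronglyMeasurable K (Eventually.of_forall h)

/-- the lower rate -/
def lowRate (a : ℕ → X → ℝ) (x : X) : ℝ := liminf (fun n : ℕ => a n x / n) atTop

lemma lowRate_meas (hm : ∀ n, Measurable (a n)) : Measurable (lowRate a) :=
  Measurable.liminf fun n => (hm n).div_const _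

lemma lowRate_abs (hK : 0 ≤ K) (hbd : ∀ n x, |a n x| ≤ n * K) (x : X) : |lowRate a x| ≤ K :=
  abs_liminf_le (div_abs_le hK fun n => hbd n x)

lemma lowRate_le_comp (hK : 0 ≤ K) (hbd : ∀ n x, |a n x| ≤ n * K)
    (hsub : ∀ m n x, a (m + n) x ≤ a m x + a n (T^[m] x)) (x : X) :
    lowRate a x ≤ lowRate a (T x) := by
  refine le_of_forall_lt_imp_le_of_dense fun b hb => ?_
  obtain ⟨b', hbb', hb'⟩ := exists_between hb
  have h1 : ∀ᶠ n : ℕ in atTop, b' < a n x / n :=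
    eventually_lt_of_lt_liminf hb' (bddGe (div_abs_le hK fun n => hbd n x))
  have h2 : ∀ᶠ n : ℕ in atTop, b < a n (T x) / n := by
    have h3 : ∀ᶠ n : ℕ in atTop, (2 * K + 1) / (b' - b) < n :=
      tendsto_natCast_atTop_atTop.eventually_gt_atTop _
    have h4 := (tendsto_add_atTop_nat 1).eventually h1
    filter_upwards [h3, h4, eventually_gt_atTop 0] with n hn hn' hn0
    have hn0' : (0:ℝ) < n := by exact_mod_cast hn0
    have h5 := hsub 1 n x
    have h6 := (abs_le.1 (hbd 1 x)).2
    rw [div_lt_iff₀ (by linarith)] at hn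
    rw [lt_div_iff₀ (by positivity)] at hn'
    rw [lt_div_iff₀ hn0']
    have hb'K : -K ≤ b' ∨ b' < -K := le_or_gt _ _
    rw [add_comm] at h5
    simp only [Function.iterate_one] at h5
    push_cast at *
    rcases hb'K with h | h
    · nlinarith
    · have := (abs_le.1 (hbd n (T x))).1
      nlinarith
  exact le_liminf_of_le (bddLe (div_abs_le hK fun n => hbd n (T x))).isCoboundedUnder_ge
    (h2.mono fun n hn => hn.le)

lemma lowRate_inv (hT : MeasurePreserving T μ μ) (hK : 0 ≤ K) (hm : ∀ n, Measurable (a n))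
    (hbd : ∀ n x, |a n x| ≤ n * K)
    (hsub : ∀ m n x, a (m + n) x ≤ a m x + a n (T^[m] x)) :
    ∀ᵐ x ∂μ, ∀ k, lowRate a (T^[k] x) = lowRate a x := by
  have hg := lowRate_meas hm
  have hgi : Integrable (lowRate a) μ := integrable_bdd hg (lowRate_abs hK hbd)
  have hgi' : Integrable (fun x => lowRate a (T x)) μ :=
    integrable_bdd (hg.comp hT.measurable) (fun x => lowRate_abs hK hbd (T x))
  have h1 : ∀ᵐ x ∂μ, lowRate a (T x) = lowRate a x := by
    have h2 : ∫ x, (lowRate a (T x) - lowRate a x) ∂μ = 0 := by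
      rw [integral_sub hgi' hgi, ← integral_map hT.measurable.aemeasurable
        (by rw [hT.map_eq]; exact hg.aestronglyMeasurable), hT.map_eq, sub_self]
    have h3 := (integral_eq_zero_iff_of_nonneg
      (fun x => sub_nonneg.2 (lowRate_le_comp hK hbd hsub x)) (hgi'.sub hgi)).1 h2
    filter_upwards [h3] with x hx
    simpa [sub_eq_zero] using hx
  have h4 : ∀ᵐ x ∂μ, ∀ k, lowRate a (T (T^[k] x)) = lowRate a (T^[k] x) := by
    rw [ae_all_iff]
    intro k
    exact (hT.iterate k).quasiMeasurePreserving.ae h1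
  filter_upwards [h4] with x hx k
  induction k with
  | zero => rfl
  | succ k ih => rw [Function.iterate_succ_apply', hx, ih]

/-- bad set -/
def badSet (a : ℕ → X → ℝ) (ε : ℝ) (N : ℕ) : Set X :=
  {x | ∀ l : ℕ, 1 ≤ l → l ≤ N → l * (lowRate a x + ε) < a l x}

lemma badSet_meas (hm : ∀ n, Measurable (a n)) (ε : ℝ) (N : ℕ) :
    MeasurableSet (badSet a ε N) := by
  have hg := lowRate_meas hm
  have : badSet a ε N = ⋂ l : ℕ, ⋂ (_ : 1 ≤ l), ⋂ (_ : l ≤ N),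
      {x | l * (lowRate a x + ε) < a l x} := by
    ext x; simp [badSet]
  rw [this]
  refine MeasurableSet.iInter fun l => MeasurableSet.iInter fun _ => MeasurableSet.iInter fun _ => ?_
  exact measurableSet_lt ((hg.add_const _).const_mul _) (hm l)

lemma badSet_tendsto (hK : 0 ≤ K) (hm : ∀ n, Measurable (a n))
    (hbd : ∀ n x, |a n x| ≤ n * K) {ε : ℝ} (hε : 0 < ε) :
    Tendsto (fun N => μ.real (badSet a ε N)) atTop (𝓝 0) := by
  have h1 : Tendsto (fun N => μ (badSet a ε N)) atTop (𝓝 (μ (⋂ N, badSet a ε N))) :=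
    tendsto_measure_iInter_atTop (fun N => (badSet_meas hm ε N).nullMeasurableSet)
      (fun N M h x hx l hl1 hl2 => hx l hl1 (hl2.trans h)) ⟨0, measure_ne_top _ _⟩
  have h2 : ⋂ N, badSet a ε N = ∅ := by
    rw [Set.eq_empty_iff_forall_notMem]
    intro x hx
    rw [mem_iInter] at hx
    have h3 : ∃ᶠ n : ℕ in atTop, a n x / n < lowRate a x + ε := by
      apply frequently_lt_of_liminf_lt (bddLe (div_abs_le hK fun n => hbd n x)).isCoboundedUnder_ge
      show lowRate a x < _
      linarith
    obtain ⟨n, hn, hn1⟩ := (h3.and_eventually (eventually_ge_atTop 1)).exists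
    have h4 := hx n n hn1 le_rfl
    have : (0:ℝ) < n := by exact_mod_cast hn1
    rw [div_lt_iff₀ this] at hn
    linarith
  rw [h2, measure_empty] at h1
  have := (ENNReal.tendsto_toReal ENNReal.zero_ne_top).comp h1
  simpa [Measure.real, Function.comp_def] using this

lemma main_bound (hT : MeasurePreserving T μ μ) (hK : 0 ≤ K) (hm : ∀ n, Measurable (a n))
    (hbd : ∀ n x, |a n x| ≤ n * K)
    (hsub : ∀ m n x, a (m + n) x ≤ a m x + a n (T^[m] x)) {ε : ℝ} (hε : 0 < ε) (N : ℕ) :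
    ∀ᵐ x ∂μ, ∀ n : ℕ, a n x ≤ n * (lowRate a x + ε) +
      2 * K * (birkhoffSum T ((badSet a ε N).indicator fun _ => (1:ℝ)) n x + N) := by
  filter_upwards [lowRate_inv hT hK hm hbd hsub] with x hx n
  have := (abs_le.1 (lowRate_abs hK hbd x)).1
  refine comb_bound T a K hK hbd hsub (lowRate a x + ε) (by linarith) _ N n x ?_
  intro k hk
  simp only [badSet, mem_ofPred_eq, not_forall, not_lt] at hk
  obtain ⟨l, h1, h2, h3⟩ := hk
  exact ⟨l, h1, h2, by rwa [hx k] at h3⟩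

lemma birk_meas {φ : X → ℝ} (hT : Measurable T) (hφ : Measurable φ) (n : ℕ) :
    Measurable (birkhoffSum T φ n) := by
  unfold birkhoffSum
  exact Finset.measurable_sum _ fun k _ => hφ.comp (hT.iterate k)

lemma birk_abs {φ : X → ℝ} (hφK : ∀ x, |φ x| ≤ K) (n : ℕ) (x : X) :
    |birkhoffSum T φ n x| ≤ n * K := by
  unfold birkhoffSum
  refine (Finset.abs_sum_le_sum_abs _ _).trans ?_
  refine (Finset.sum_le_sum fun k _ => hφK _).trans ?_
  simp

lemma birk_integral {φ : X → ℝ} (hT : MeasurePreserving T μ μ) (hφ : Measurable φ)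
    (hφK : ∀ x, |φ x| ≤ K) (n : ℕ) :
    ∫ x, birkhoffSum T φ n x ∂μ = n * ∫ x, φ x ∂μ := by
  unfold birkhoffSum
  rw [integral_finsetSum]
  · have : ∀ k, ∫ x, φ (T^[k] x) ∂μ = ∫ x, φ x ∂μ := fun k => by
      rw [← integral_map (hT.iterate k).measurable.aemeasurable
        (by rw [(hT.iterate k).map_eq]; exact hφ.aestronglyMeasurable), (hT.iterate k).map_eq]
    simp [this]
  · intro k _
    exact integrable_bdd (hφ.comp (hT.iterate k).measurable) (fun x => hφK _)

/-- integral of the lower rate is at least the asymptotic rate of integrals -/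
lemma integral_lowRate_ge (hT : MeasurePreserving T μ μ) (hK : 0 ≤ K)
    (hm : ∀ n, Measurable (a n)) (hbd : ∀ n x, |a n x| ≤ n * K)
    (hsub : ∀ m n x, a (m + n) x ≤ a m x + a n (T^[m] x)) {L : ℝ}
    (hL : ∀ n : ℕ, n * L ≤ ∫ x, a n x ∂μ) : L ≤ ∫ x, lowRate a x ∂μ := by
  have hgi : Integrable (lowRate a) μ := integrable_bdd (lowRate_meas hm) (lowRate_abs hK hbd)
  refine le_of_forall_pos_le_add fun ε hε => ?_
  have key : ∀ N : ℕ, L ≤ ∫ x, lowRate a x ∂μ + ε + 2 * K * μ.real (badSet a ε N) := by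
    intro N
    set φ : X → ℝ := (badSet a ε N).indicator fun _ => (1:ℝ) with hφ
    have hφm : Measurable φ := measurable_const.indicator (badSet_meas hm ε N)
    have hφK : ∀ x, |φ x| ≤ 1 := by
      intro x
      by_cases h : x ∈ badSet a ε N <;> simp [hφ, h]
    have hφi : ∫ x, φ x ∂μ = μ.real (badSet a ε N) := by
      rw [hφ, integral_indicator (badSet_meas hm ε N)]; simp
    have h1 : ∀ n : ℕ, n * L ≤ n * (∫ x, lowRate a x ∂μ + ε + 2 * K * μ.real (badSet a ε N))
        + 2 * K * N := by
      intro n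
      refine (hL n).trans ?_
      have hbi : Integrable (birkhoffSum T φ n) μ :=
        integrable_bdd (birk_meas hT.measurable hφm n) (birk_abs hφK n)
      have h2 : ∫ x, a n x ∂μ ≤ ∫ x, (n * (lowRate a x + ε) +
          2 * K * (birkhoffSum T φ n x + N)) ∂μ := by
        refine integral_mono_ae (integrable_bdd (hm n) (hbd n)) ?_ ?_
        · exact ((hgi.add (integrable_const _)).const_mul _).add
            ((hbi.add (integrable_const _)).const_mul _)
        · filter_upwards [main_bound hT hK hm hbd hsub hε N] with x hx using hx n
      refine h2.trans (le_of_eq ?_)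
      have e1 : Integrable (fun x => n * (lowRate a x + ε)) μ :=
        (hgi.add (integrable_const _)).const_mul _
      have e2 : Integrable (fun x => 2 * K * (birkhoffSum T φ n x + N)) μ :=
        (hbi.add (integrable_const _)).const_mul _
      rw [integral_add e1 e2, integral_const_mul, integral_const_mul,
          integral_add hgi (integrable_const _), integral_add hbi (integrable_const _),
          birk_integral hT hφm hφK, hφi]
      simp
      ring
    by_contra hcon
    push Not at hcon
    set R := ∫ x, lowRate a x ∂μ + ε + 2 * K * μ.real (badSet a ε N)
    obtain ⟨n, hn⟩ := exists_nat_gt (2 * K * N / (L - R))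
    rw [div_lt_iff₀ (by linarith)] at hn
    have := h1 n
    nlinarith
  have h3 := (badSet_tendsto (μ := μ) hK hm hbd hε).const_mul (2 * K)
  have h4 := h3.const_add (∫ x, lowRate a x ∂μ + ε)
  simp only [mul_zero, add_zero] at h4
  exact ge_of_tendsto' h4 key

/-- integral of the upper Birkhoff average of a bounded function. -/
lemma integral_limsup_birk (hT : MeasurePreserving T μ μ) (hK : 0 ≤ K) {φ : X → ℝ}
    (hφ : Measurable φ) (hφK : ∀ x, |φ x| ≤ K) :
    ∫ x, limsup (fun n : ℕ => birkhoffSum T φ n x / n) atTop ∂μ ≤ ∫ x, φ x ∂μ := by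
  have h := integral_lowRate_ge (μ := μ) (T := T) (a := fun n x => - birkhoffSum T φ n x)
    (K := K) (L := - ∫ x, φ x ∂μ) hT hK (fun n => (birk_meas hT.measurable hφ n).neg)
    (fun n x => by rw [abs_neg]; exact birk_abs hφK n x)
    (fun m n x => by rw [birkhoffSum_add]; linarith)
    (fun n => by rw [integral_neg, birk_integral hT hφ hφK]; linarith)
  have hb := fun x => div_abs_le hK fun n => birk_abs (T := T) hφK n x
  have hbd' : ∀ n x, |- birkhoffSum T φ n x| ≤ n * K := fun n x => by
    rw [abs_neg]; exact birk_abs hφK n x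
  have h2 : ∀ x, limsup (fun n : ℕ => birkhoffSum T φ n x / n) atTop ≤
      - lowRate (fun n x => - birkhoffSum T φ n x) x := by
    intro x
    refine le_of_forall_gt_imp_ge_of_dense fun b hlt => ?_
    have h3 : ∀ᶠ n : ℕ in atTop, -b < (- birkhoffSum T φ n x) / n :=
      eventually_lt_of_lt_liminf (by unfold lowRate at hlt; linarith)
        (bddGe (div_abs_le hK fun n => hbd' n x))
    refine limsup_le_of_le (bddGe (hb x)).isCoboundedUnder_le ?_
    filter_upwards [h3] with n hn
    rw [neg_div] at hn
    linarith
  have hmm : ∀ n, Measurable fun x => - birkhoffSum T φ n x :=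
    fun n => (birk_meas hT.measurable hφ n).neg
  have h4 := integral_mono (μ := μ)
    (integrable_bdd (Measurable.limsup fun n => (birk_meas hT.measurable hφ n).div_const _)
      fun x => abs_limsup_le (hb x))
    (integrable_bdd (lowRate_meas hmm) (lowRate_abs hK hbd')).neg h2
  simp only [Pi.neg_apply] at h4
  rw [integral_neg] at h4
  linarith

theorem kingman (hT : MeasurePreserving T μ μ) (hK : 0 ≤ K)
    (hm : ∀ n, Measurable (a n)) (hbd : ∀ n x, |a n x| ≤ n * K)
    (hsub : ∀ m n x, a (m + n) x ≤ a m x + a n (T^[m] x)) :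
    ∀ᵐ x ∂μ, Tendsto (fun n : ℕ => a n x / n) atTop (𝓝 (lowRate a x)) := by
  have hgi : Integrable (lowRate a) μ := integrable_bdd (lowRate_meas hm) (lowRate_abs hK hbd)
  set G : X → ℝ := fun x => limsup (fun n : ℕ => a n x / n) atTop with hG
  have hGm : Measurable G := Measurable.limsup fun n => (hm n).div_const _
  have hGK : ∀ x, |G x| ≤ K := fun x => abs_limsup_le (div_abs_le hK fun n => hbd n x)
  have hGi : Integrable G μ := integrable_bdd hGm hGK
  have hle : ∀ x, lowRate a x ≤ G x := fun x =>
    liminf_le_limsup (bddLe (div_abs_le hK fun n => hbd n x))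
      (bddGe (div_abs_le hK fun n => hbd n x))
  have key : ∀ ε > 0, ∫ x, G x ∂μ ≤ ∫ x, lowRate a x ∂μ + ε := by
    intro ε hε
    have hN : ∀ N : ℕ, ∫ x, G x ∂μ ≤ ∫ x, lowRate a x ∂μ + ε + 2 * K * μ.real (badSet a ε N) := by
      intro N
      set φ : X → ℝ := (badSet a ε N).indicator fun _ => (1:ℝ) with hφ
      have hφm : Measurable φ := measurable_const.indicator (badSet_meas hm ε N)
      have hφK : ∀ x, |φ x| ≤ 1 := by
        intro x
        by_cases h : x ∈ badSet a ε N <;> simp [hφ, h]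
      have hφi : ∫ x, φ x ∂μ = μ.real (badSet a ε N) := by
        rw [hφ, integral_indicator (badSet_meas hm ε N)]; simp
      have hb : ∀ x n, |birkhoffSum T φ n x / n| ≤ 1 := fun x =>
        div_abs_le zero_le_one fun n => birk_abs hφK n x
      have hHm : Measurable fun x => limsup (fun n : ℕ => birkhoffSum T φ n x / n) atTop :=
        Measurable.limsup fun n => (birk_meas hT.measurable hφm n).div_const _
      have hHi : Integrable (fun x => limsup (fun n : ℕ => birkhoffSum T φ n x / n) atTop) μ :=
        integrable_bdd hHm fun x => abs_limsup_le (hb x)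
      have h1 : ∀ᵐ x ∂μ, G x ≤ (lowRate a x + ε) +
          2 * K * limsup (fun n : ℕ => birkhoffSum T φ n x / n) atTop := by
        filter_upwards [main_bound hT hK hm hbd hsub hε N] with x hx
        refine le_of_forall_pos_le_add fun δ hδ => ?_
        set H := limsup (fun n : ℕ => birkhoffSum T φ n x / n) atTop
        set δ' := δ / (2 * (2 * K + 1)) with hδ'
        have hδ'0 : 0 < δ' := by positivity
        have h2 : ∀ᶠ n : ℕ in atTop, birkhoffSum T φ n x / n < H + δ' :=
          eventually_lt_of_limsup_lt (by linarith) (bddLe (hb x))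
        have h3 : ∀ᶠ n : ℕ in atTop, N / δ' < (n:ℝ) :=
          tendsto_natCast_atTop_atTop.eventually_gt_atTop _
        refine limsup_le_of_le
          (bddGe (div_abs_le hK fun n => hbd n x)).isCoboundedUnder_le ?_
        filter_upwards [h2, h3, eventually_gt_atTop 0] with n hn2 hn3 hn0
        have hn0' : (0:ℝ) < n := by exact_mod_cast hn0
        rw [div_lt_iff₀ hn0'] at hn2
        rw [div_lt_iff₀ hδ'0] at hn3
        rw [div_le_iff₀ hn0']
        refine (hx n).trans ?_
        have h5 : 2 * K * (birkhoffSum T φ n x + N) ≤ 2 * K * ((H + δ') * n + n * δ') :=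
          mul_le_mul_of_nonneg_left (by linarith) (by linarith)
        have h6 : 2 * K * (2 * δ') ≤ δ := by
          rw [hδ']
          rw [show 2 * K * (2 * (δ / (2 * (2 * K + 1)))) = δ * (2 * K / (2 * K + 1)) by
            field_simp]
          refine mul_le_of_le_one_right hδ.le ?_
          rw [div_le_one (by linarith)]; linarith
        nlinarith
      calc ∫ x, G x ∂μ ≤ ∫ x, ((lowRate a x + ε) +
          2 * K * limsup (fun n : ℕ => birkhoffSum T φ n x / n) atTop) ∂μ :=
            integral_mono_ae hGi ((hgi.add (integrable_const _)).add (hHi.const_mul _)) h1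
        _ = ∫ x, lowRate a x ∂μ + ε +
          2 * K * ∫ x, limsup (fun n : ℕ => birkhoffSum T φ n x / n) atTop ∂μ := by
            have e1 : Integrable (fun x => lowRate a x + ε) μ := hgi.add (integrable_const _)
            rw [integral_add e1 (hHi.const_mul _),
              integral_add hgi (integrable_const _), integral_const_mul]
            simp
        _ ≤ _ := by
            have := integral_limsup_birk hT zero_le_one hφm hφK
            rw [hφi] at this
            have := mul_le_mul_of_nonneg_left this (show 0 ≤ 2 * K by linarith)
            linarith
    have h3 := (badSet_tendsto (μ := μ) hK hm hbd hε).const_mul (2 * K)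
    have h4 := h3.const_add (∫ x, lowRate a x ∂μ + ε)
    simp only [mul_zero, add_zero] at h4
    exact ge_of_tendsto' h4 hN
  have h0 : ∫ x, (G x - lowRate a x) ∂μ = 0 := by
    rw [integral_sub hGi hgi]
    have h1 := le_of_forall_pos_le_add key
    have h2 := integral_mono hgi hGi hle
    linarith
  have h3 := (integral_eq_zero_iff_of_nonneg (fun x => sub_nonneg.2 (hle x)) (hGi.sub hgi)).1 h0
  filter_upwards [h3] with x hx
  have hx' : G x = lowRate a x := by simpa [sub_eq_zero] using hx
  exact tendsto_of_le_liminf_of_limsup_le le_rfl hx'.le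
    (bddLe (div_abs_le hK fun n => hbd n x)) (bddGe (div_abs_le hK fun n => hbd n x))

end Kingman

section Transfer

variable {X : Type*} [MeasurableSpace X] [StandardBorelSpace X] {μ : Measure X}
  [IsProbabilityMeasure μ] {ι : Type*} [Fintype ι]

/-- the inverse branch of `φ` along `g` on the set `A`. -/
def branch (g : X → X) (A : Set X) (φ : X → ℝ) : X → ℝ :=
  Function.extend (fun a : A => g a) (fun a : A => φ a) 0

lemma branch_apply {g : X → X} {A : Set X} (hA : InjOn g A) (φ : X → ℝ) {y : X} (hy : y ∈ A) :
    branch g A φ (g y) = φ y := by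
  have : Function.Injective (fun a : A => g a) := injOn_iff_injective.1 hA
  exact this.extend_apply (fun a : A => φ a) 0 ⟨y, hy⟩

lemma branch_zero {g : X → X} {A : Set X} (φ : X → ℝ) {x : X} (hx : x ∉ g '' A) :
    branch g A φ x = 0 := by
  unfold branch
  rw [Function.extend_apply']
  · rfl
  · rintro ⟨a, rfl⟩
    exact hx ⟨a, a.2, rfl⟩

lemma branch_meas {g : X → X} (hg : Measurable g) {A : Set X} (hAm : MeasurableSet A)
    (hA : InjOn g A) {φ : X → ℝ} (hφ : Measurable φ) : Measurable (branch g A φ) := by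
  have := hAm.standardBorel
  have hi : Function.Injective (fun a : A => g a) := injOn_iff_injective.1 hA
  have he := (hg.comp measurable_subtype_coe : Measurable (fun a : A => g a)).measurableEmbedding hi
  exact he.measurable_extend (hφ.comp measurable_subtype_coe) measurable_const

lemma branch_abs {g : X → X} {A : Set X} (hA : InjOn g A) {φ : X → ℝ} {K : ℝ} (hK : 0 ≤ K)
    (hφK : ∀ x, |φ x| ≤ K) (x : X) : |branch g A φ x| ≤ K := by
  by_cases hx : x ∈ g '' A
  · obtain ⟨y, hy, rfl⟩ := hx
    rw [branch_apply hA φ hy]; exact hφK y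
  · rw [branch_zero φ hx]; simpa using hK

lemma finsum_branch (g : X → X) (P : X → ι) (hP : ∀ i, InjOn g (P ⁻¹' {i})) (φ : X → ℝ) (x : X) :
    ∑ᶠ y ∈ g ⁻¹' {x}, φ y = ∑ i, branch g (P ⁻¹' {i}) φ x := by
  classical
  have hfin : (g ⁻¹' {x}).Finite := by
    refine Set.Finite.of_finite_image (f := P) (Set.toFinite _) ?_
    intro y hy z hz hyz
    exact hP (P z) (by simpa using hyz) (by simp) (by rw [hy, hz])
  rw [finsum_mem_eq_finite_toFinset_sum _ hfin, ← Finset.sum_fiberwise _ P]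
  refine Finset.sum_congr rfl fun i _ => ?_
  by_cases hx : x ∈ g '' (P ⁻¹' {i})
  · obtain ⟨y, hy, rfl⟩ := hx
    rw [branch_apply (hP i) φ hy]
    rw [Finset.sum_eq_single y]
    · intro z hz hzy
      simp only [Finset.mem_filter, Finite.mem_toFinset, mem_preimage, mem_singleton_iff] at hz
      exact absurd (hP i hz.2 hy hz.1) hzy
    · intro h
      simp only [Finset.mem_filter, Finite.mem_toFinset, mem_preimage, mem_singleton_iff,
        true_and] at h
      exact absurd hy h
  · rw [branch_zero φ hx]
    refine Finset.sum_eq_zero fun z hz => ?_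
    simp only [Finset.mem_filter, Finite.mem_toFinset, mem_preimage, mem_singleton_iff] at hz
    exact absurd ⟨z, hz.2, hz.1⟩ hx

lemma branch_integral {g : X → X} (hg : Measurable g) {D : ℕ} (hD : 1 ≤ D)
    (hμ : ∀ s, MeasurableSet s → InjOn g s → μ (g '' s) = (D : ℝ≥0∞) * μ s)
    {A : Set X} (hAm : MeasurableSet A) (hA : InjOn g A) {φ : X → ℝ} (hφ : Measurable φ)
    {B : Set X} (hB : MeasurableSet B) :
    ∫ y in A ∩ g ⁻¹' B, φ y ∂μ = (D : ℝ)⁻¹ * ∫ x in B, branch g A φ x ∂μ := by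
  have hgA : MeasurableSet (g '' A) := hAm.image_of_measurable_injOn hg hA
  have hD0 : (D : ℝ≥0∞) ≠ 0 := by
    simp; omega
  have hDt : (D : ℝ≥0∞) ≠ ⊤ := ENNReal.natCast_ne_top D
  have hmap : Measure.map g (μ.restrict A) = (D : ℝ≥0∞)⁻¹ • μ.restrict (g '' A) := by
    ext S hS
    rw [Measure.map_apply hg hS, Measure.restrict_apply (hg hS), Measure.smul_apply,
      Measure.restrict_apply hS, smul_eq_mul]
    have h1 := hμ (g ⁻¹' S ∩ A) ((hg hS).inter hAm) (hA.mono inter_subset_right)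
    rw [show g '' (g ⁻¹' S ∩ A) = S ∩ g '' A by rw [inter_comm, image_inter_preimage, inter_comm]]
      at h1
    rw [h1, ← mul_assoc, ENNReal.inv_mul_cancel hD0 hDt, one_mul]
  calc ∫ y in A ∩ g ⁻¹' B, φ y ∂μ = ∫ y in A ∩ g ⁻¹' B, branch g A φ (g y) ∂μ := by
        refine setIntegral_congr_fun (hAm.inter (hg hB)) fun y hy => ?_
        exact (branch_apply hA φ hy.1).symm
    _ = ∫ y in g ⁻¹' B, branch g A φ (g y) ∂(μ.restrict A) := by
        rw [Measure.restrict_restrict (hg hB), inter_comm]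
    _ = ∫ x in B, branch g A φ x ∂(Measure.map g (μ.restrict A)) := by
        rw [setIntegral_map hB (branch_meas hg hAm hA hφ).aestronglyMeasurable hg.aemeasurable]
    _ = (D : ℝ)⁻¹ * ∫ x in B, branch g A φ x ∂(μ.restrict (g '' A)) := by
        rw [hmap, Measure.restrict_smul, integral_smul_measure]
        simp
    _ = _ := by
        congr 1
        rw [Measure.restrict_restrict hB]
        symm
        refine setIntegral_eq_of_subset_of_forall_sdiff_eq_zero hB inter_subset_left ?_
        intro x hx
        exact branch_zero φ fun h => hx.2 ⟨hx.1, h⟩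

lemma transfer {g : X → X} (hg : Measurable g) {D : ℕ} (hD : 1 ≤ D)
    (hμ : ∀ s, MeasurableSet s → InjOn g s → μ (g '' s) = (D : ℝ≥0∞) * μ s)
    (P : X → ι) (hPm : ∀ i, MeasurableSet (P ⁻¹' {i})) (hP : ∀ i, InjOn g (P ⁻¹' {i}))
    {φ : X → ℝ} (hφ : Measurable φ) {K : ℝ} (hK : 0 ≤ K) (hφK : ∀ x, |φ x| ≤ K) {b : ℝ}
    (hb : ∀ x, b ≤ (D : ℝ)⁻¹ * ∑ᶠ y ∈ g ⁻¹' {x}, φ y) {B : Set X} (hB : MeasurableSet B) :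
    b * μ.real B ≤ ∫ y in g ⁻¹' B, φ y ∂μ := by
  have hφi : Integrable φ μ :=
    Integrable.of_bound hφ.aestronglyMeasurable K (Eventually.of_forall hφK)
  have hbi : ∀ i, Integrable (branch g (P ⁻¹' {i}) φ) μ := fun i =>
    Integrable.of_bound (branch_meas hg (hPm i) (hP i) hφ).aestronglyMeasurable K
      (Eventually.of_forall (branch_abs (hP i) hK hφK))
  have h1 : g ⁻¹' B = ⋃ i, (P ⁻¹' {i} ∩ g ⁻¹' B) := by
    ext y; simp
  have h2 : ∫ y in g ⁻¹' B, φ y ∂μ = ∑ i, ∫ y in P ⁻¹' {i} ∩ g ⁻¹' B, φ y ∂μ := by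
    conv_lhs => rw [h1]
    rw [integral_iUnion_fintype (fun i => (hPm i).inter (hg hB)) _ (fun i => hφi.integrableOn)]
    intro i j hij
    refine Disjoint.mono inter_subset_left inter_subset_left ?_
    rw [Set.disjoint_left]
    intro y hy hy'
    exact hij (hy.symm.trans hy')
  rw [h2]
  simp_rw [fun i => branch_integral hg hD hμ (hPm i) (hP i) hφ hB]
  rw [← Finset.mul_sum, ← integral_finsetSum _ (fun i _ => (hbi i).integrableOn),
    ← integral_const_mul]
  have h3 : b * μ.real B = ∫ x in B, b ∂μ := by simp [mul_comm]
  rw [h3]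
  refine integral_mono (integrable_const _)
    ((integrable_finsetSum _ (fun i _ => (hbi i).integrableOn)).const_mul _) fun x => ?_
  simp only
  rw [← finsum_branch g P hP φ x]
  exact hb x

lemma iter_inj {T : X → X} {P : X → ι} (hP : ∀ i, InjOn T (P ⁻¹' {i})) :
    ∀ (n : ℕ) (x y : X), (∀ k < n, P (T^[k] x) = P (T^[k] y)) → T^[n] x = T^[n] y → x = y := by
  intro n
  induction n with
  | zero => intro x y _ h; exact h
  | succ n ih =>
    intro x y h hxy
    refine ih x y (fun k hk => h k (by omega)) ?_
    rw [Function.iterate_succ_apply', Function.iterate_succ_apply'] at hxy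
    exact hP (P (T^[n] y)) (h n (by omega)) rfl hxy

lemma iter_equi {T : X → X} (hT : Measurable T) {D : ℕ}
    (hμ : ∀ s, MeasurableSet s → InjOn T s → μ (T '' s) = (D : ℝ≥0∞) * μ s) (n : ℕ) :
    ∀ s, MeasurableSet s → InjOn T^[n] s → μ (T^[n] '' s) = ((D ^ n : ℕ) : ℝ≥0∞) * μ s := by
  induction n with
  | zero => intro s _ _; simp
  | succ n ih =>
    intro s hs hi
    have h1 : InjOn T s := by
      intro x hx y hy hxy
      apply hi hx hy
      rw [Function.iterate_succ_apply, Function.iterate_succ_apply, hxy]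
    have h2 : InjOn T^[n] (T '' s) := by
      rintro _ ⟨x, hx, rfl⟩ _ ⟨y, hy, rfl⟩ hxy
      rw [← Function.iterate_succ_apply, ← Function.iterate_succ_apply] at hxy
      rw [hi hx hy hxy]
    rw [Function.iterate_succ, image_comp, ih _ (hs.image_of_measurable_injOn hT h1) h2, hμ s hs h1]
    push_cast
    ring

lemma transfer_iter {T : X → X} (hT : Measurable T) {D : ℕ} (hD : 1 ≤ D)
    (hμ : ∀ s, MeasurableSet s → InjOn T s → μ (T '' s) = (D : ℝ≥0∞) * μ s)
    (P : X → ι) (hPm : ∀ i, MeasurableSet (P ⁻¹' {i})) (hP : ∀ i, InjOn T (P ⁻¹' {i})) (n : ℕ)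
    {φ : X → ℝ} (hφ : Measurable φ) {K : ℝ} (hK : 0 ≤ K) (hφK : ∀ x, |φ x| ≤ K) {b : ℝ}
    (hb : ∀ x, b ≤ ((D : ℝ) ^ n)⁻¹ * ∑ᶠ y ∈ T^[n] ⁻¹' {x}, φ y) {B : Set X}
    (hB : MeasurableSet B) :
    b * μ.real B ≤ ∫ y in T^[n] ⁻¹' B, φ y ∂μ := by
  classical
  refine transfer (ι := Fin n → ι) (hT.iterate n) (D := D ^ n) (Nat.one_le_pow _ _ hD)
    (iter_equi hT hμ n) (fun x k => P (T^[k] x)) ?_ ?_ hφ hK hφK (by simpa using hb) hB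
  · intro i
    have : (fun x (k : Fin n) => P (T^[k] x)) ⁻¹' {i} =
        ⋂ k : Fin n, T^[k] ⁻¹' (P ⁻¹' {i k}) := by
      ext x; simp [funext_iff]
    rw [this]
    exact MeasurableSet.iInter fun k => hT.iterate k (hPm _)
  · intro i x hx y hy hxy
    refine iter_inj hP n x y (fun k hk => ?_) hxy
    exact congrFun (hx.trans hy.symm) ⟨k, hk⟩

end Transfer

section Geometry

lemma proj_oq : IsOpenQuotientMap proj := by
  have h1 : IsOpenQuotientMap (Prod.map (fun x : ℝ => (x : AddCircle (1:ℝ)))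
      (fun x : ℝ => (x : AddCircle (1:ℝ)))) :=
    IsOpenQuotientMap.prodMap QuotientAddGroup.isOpenQuotientMap_mk
      QuotientAddGroup.isOpenQuotientMap_mk
  let e : V2 ≃ₜ ℝ × ℝ :=
    (EuclideanSpace.equiv (Fin 2) ℝ).toHomeomorph.trans (Homeomorph.piFinTwo fun _ => ℝ)
  have h2 : IsOpenQuotientMap e := ⟨e.surjective, e.continuous, e.isOpenMap⟩
  exact h1.comp h2

lemma proj_inj_small {p q : V2} (h : proj p = proj q) (hd : dist p q < 1) : p = q := by
  have hi : ∀ i : Fin 2, (p i : AddCircle (1:ℝ)) = (q i : AddCircle (1:ℝ)) := by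
    intro i
    have h1 := congrArg Prod.fst h
    have h2 := congrArg Prod.snd h
    fin_cases i
    · exact h1
    · exact h2
  ext i
  have h1 := hi i
  have h2 : ((p i - q i : ℝ) : AddCircle (1:ℝ)) = 0 := by
    rw [AddCircle.coe_sub, h1, sub_self]
  obtain ⟨n, hn⟩ := (AddCircle.coe_eq_zero_iff (1:ℝ)).1 h2
  have h3 : |p i - q i| < 1 := by
    have h4 := PiLp.norm_apply_le (p - q) i
    rw [← dist_eq_norm] at h4
    exact lt_of_le_of_lt h4 hd
  rw [← hn] at h3
  simp only [zsmul_eq_mul, mul_one] at h3 hn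
  have h5 : |n| < 1 := by exact_mod_cast h3
  have h6 : n = 0 := Int.abs_lt_one_iff.1 h5
  rw [h6] at hn
  simp at hn
  linarith

variable {r : ℕ}

lemma toFun_cont (f : TorusMap r) : Continuous f.toFun := by
  rw [← proj_oq.continuous_comp_iff]
  have : f.toFun ∘ proj = proj ∘ f.F := funext f.toFun_proj
  rw [this]
  exact proj_oq.continuous.comp f.contDiff.continuous

lemma D_cont (f : TorusMap 2) : Continuous f.D := by
  rw [← proj_oq.continuous_comp_iff]
  have : f.D ∘ proj = fderiv ℝ f.F := funext f.D_proj
  rw [this]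
  exact f.contDiff.continuous_fderiv (by norm_num)

lemma loc_inj (f : TorusMap 2) (x : T2) :
    ∃ U : Set T2, IsOpen U ∧ x ∈ U ∧ InjOn f.toFun U := by
  obtain ⟨p, rfl⟩ := proj_oq.surjective x
  have hu := f.isUnit_D (proj p)
  rw [f.D_proj] at hu
  obtain ⟨u, hu⟩ := hu
  let e : V2 ≃L[ℝ] V2 := ContinuousLinearEquiv.unitsEquiv ℝ V2 u
  have hst : HasStrictFDerivAt f.F (e : V2 →L[ℝ] V2) p := by
    have h1 := (f.contDiff.contDiffAt (x := p)).hasStrictFDerivAt (by norm_num)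
    have h2 : (e : V2 →L[ℝ] V2) = fderiv ℝ f.F p := by rw [← hu]; ext v; rfl
    rw [h2]; exact h1
  let φ := hst.toOpenPartialHomeomorph f.F
  have hp : p ∈ φ.source := hst.mem_toOpenPartialHomeomorph_source
  have hφ : ∀ z, φ z = f.F z := fun z => rfl
  let W : Set V2 := φ.source ∩ f.F ⁻¹' Metric.ball (f.F p) (1/2)
  have hW : IsOpen W := φ.open_source.inter (Metric.isOpen_ball.preimage f.contDiff.continuous)
  refine ⟨proj '' W, proj_oq.isOpenMap _ hW, ⟨p, ⟨hp, ?_⟩, rfl⟩, ?_⟩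
  · simp
  · rintro _ ⟨a, ha, rfl⟩ _ ⟨b, hb, rfl⟩ hab
    rw [f.toFun_proj, f.toFun_proj] at hab
    have h1 := proj_inj_small hab (by
      have h3 : dist (f.F a) (f.F p) < 1/2 := ha.2
      have h4 : dist (f.F b) (f.F p) < 1/2 := hb.2
      have := dist_triangle_right (f.F a) (f.F b) (f.F p)
      linarith)
    rw [φ.injOn ha.1 hb.1 h1]

lemma exists_label (f : TorusMap 2) : ∃ (m : ℕ) (P : T2 → Fin m),
    (∀ i, MeasurableSet (P ⁻¹' {i})) ∧ ∀ i, InjOn f.toFun (P ⁻¹' {i}) := by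
  choose U hU hxU hinj using loc_inj f
  obtain ⟨t, ht⟩ := isCompact_univ.elim_finite_subcover U hU
    (fun x _ => mem_iUnion.2 ⟨x, hxU x⟩)
  let e := t.equivFin
  have hex : ∀ x : T2, ∃ n : ℕ, ∃ h : n < t.card, x ∈ U (e.symm ⟨n, h⟩) := by
    intro x
    have := ht (mem_univ x)
    simp only [mem_iUnion] at this
    obtain ⟨y, hy, hxy⟩ := this
    refine ⟨e ⟨y, hy⟩, (e ⟨y, hy⟩).2, ?_⟩
    simpa using hxy
  classical
  have hPm : Measurable fun x => Nat.find (hex x) := by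
    refine measurable_find _ fun n => ?_
    by_cases h : n < t.card
    · simpa [h] using (hU _).measurableSet
    · simp [h]
  refine ⟨t.card, fun x => ⟨Nat.find (hex x), (Nat.find_spec (hex x)).1⟩, ?_, ?_⟩
  · intro i
    have : (fun x => (⟨Nat.find (hex x), (Nat.find_spec (hex x)).1⟩ : Fin t.card)) ⁻¹' {i} =
        (fun x => Nat.find (hex x)) ⁻¹' {(i : ℕ)} := by
      ext x
      simp only [mem_preimage, mem_singleton_iff, Fin.ext_iff]
    rw [this]
    exact hPm (measurableSet_singleton _)
  · intro i
    refine (hinj (e.symm i)).mono ?_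
    rintro x rfl
    exact (Nat.find_spec (hex x)).2

lemma Dn_isUnit (f : TorusMap r) (n : ℕ) : ∀ x, IsUnit (f.Dn n x) := by
  induction n with
  | zero => intro x; exact isUnit_one
  | succ n ih => intro x; exact (ih _).mul (f.isUnit_D x)

lemma Dn_add (f : TorusMap r) (m n : ℕ) : ∀ x,
    f.Dn (m + n) x = f.Dn n (f.toFun^[m] x) * f.Dn m x := by
  induction m with
  | zero => intro x; simp only [Nat.zero_add]; exact (mul_one _).symm
  | succ m ih =>
    intro x
    rw [show m + 1 + n = (m + n) + 1 by ring]
    show f.Dn (m + n) (f.toFun x) * f.D x = f.Dn n (f.toFun^[m+1] x) * (f.Dn m (f.toFun x) * f.D x)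
    rw [ih, mul_assoc, Function.iterate_succ_apply]

lemma Dn_cont (f : TorusMap 2) (n : ℕ) : Continuous (f.Dn n) := by
  induction n with
  | zero => exact continuous_const
  | succ n ih => exact (ih.comp (toFun_cont f)).mul (D_cont f)

lemma Dninv_cont (f : TorusMap 2) (n : ℕ) : Continuous (f.Dninv n) := by
  rw [continuous_iff_continuousAt]
  intro x
  obtain ⟨u, hu⟩ := Dn_isUnit f n x
  have := NormedRing.inverse_continuousAt u
  rw [hu] at this
  exact this.comp (Dn_cont f n).continuousAt

lemma inverse_mul_units {R : Type*} [Ring R] {a b : R} (ha : IsUnit a) (hb : IsUnit b) :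
    Ring.inverse (a * b) = Ring.inverse b * Ring.inverse a := by
  obtain ⟨u, rfl⟩ := ha
  obtain ⟨v, rfl⟩ := hb
  rw [← Units.val_mul, Ring.inverse_unit, Ring.inverse_unit, Ring.inverse_unit, mul_inv_rev]
  rfl

lemma Dninv_add (f : TorusMap r) (m n : ℕ) (x : T2) :
    f.Dninv (m + n) x = f.Dninv m x * f.Dninv n (f.toFun^[m] x) := by
  unfold TorusMap.Dninv
  rw [Dn_add, inverse_mul_units (Dn_isUnit _ _ _) (Dn_isUnit _ _ _)]

lemma Dninv_mul (f : TorusMap r) (n : ℕ) (x : T2) : f.Dninv n x * f.Dn n x = 1 :=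
  Ring.inverse_mul_cancel _ (Dn_isUnit f n x)

lemma mul_Dninv (f : TorusMap r) (n : ℕ) (x : T2) : f.Dn n x * f.Dninv n x = 1 :=
  Ring.mul_inverse_cancel _ (Dn_isUnit f n x)

lemma exists_K (f : TorusMap 2) : ∃ K : ℝ, 0 ≤ K ∧
    ∀ (n : ℕ) (x : T2), ‖f.Dn n x‖ ≤ Real.exp (n * K) ∧ ‖f.Dninv n x‖ ≤ Real.exp (n * K) := by
  obtain ⟨C1, hC1⟩ := isCompact_univ.exists_bound_of_continuousOn (D_cont f).continuousOn
  obtain ⟨C2, hC2⟩ := isCompact_univ.exists_bound_of_continuousOn (Dninv_cont f 1).continuousOn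
  set M := max 1 (max C1 C2) with hM
  have hM1 : 1 ≤ M := le_max_left _ _
  refine ⟨Real.log M, Real.log_nonneg hM1, ?_⟩
  have he : ∀ n : ℕ, Real.exp (n * Real.log M) = M ^ n := fun n => by
    rw [Real.exp_nat_mul, Real.exp_log (by linarith)]
  intro n
  rw [he]
  induction n with
  | zero =>
    intro x
    have h1 : f.Dn 0 x = 1 := rfl
    have h2 : f.Dninv 0 x = 1 := by unfold TorusMap.Dninv; rw [h1, Ring.inverse_one]
    rw [h1, h2]
    simp
  | succ n ih =>
    intro x
    have h0 : (0:ℝ) ≤ M ^ n := by positivity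
    constructor
    · have h1 : f.Dn (n + 1) x = f.Dn n (f.toFun x) * f.D x := rfl
      rw [h1, pow_succ]
      refine (norm_mul_le _ _).trans ?_
      gcongr
      · exact (ih _).1
      · exact (hC1 x (mem_univ _)).trans ((le_max_left _ _).trans (le_max_right _ _))
    · have h1 := Dninv_add f 1 n x
      rw [add_comm 1 n] at h1
      rw [h1, pow_succ']
      refine (norm_mul_le _ _).trans ?_
      gcongr
      · exact (hC2 x (mem_univ _)).trans ((le_max_right _ _).trans (le_max_right _ _))
      · exact (ih _).2

lemma exists_unit_vec : ∃ v : V2, ‖v‖ = 1 := ⟨EuclideanSpace.single 0 1, by simp⟩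

lemma sphere_nonempty : Nonempty (Metric.sphere (0 : V2) 1) := by
  obtain ⟨v, hv⟩ := exists_unit_vec
  exact ⟨⟨v, by simpa using hv⟩⟩

lemma minNorm_eq {L M : V2 →L[ℝ] V2} (h1 : L * M = 1) (h2 : M * L = 1) :
    minNorm L = ‖M‖⁻¹ := by
  have := sphere_nonempty
  have hLM : ∀ v, L (M v) = v := fun v => by
    have := congrArg (fun N : V2 →L[ℝ] V2 => N v) h1; exact this
  have hML : ∀ v, M (L v) = v := fun v => by
    have := congrArg (fun N : V2 →L[ℝ] V2 => N v) h2; exact this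
  have hM : 0 < ‖M‖ := by
    rw [norm_pos_iff]
    rintro rfl
    obtain ⟨v, hv⟩ := exists_unit_vec
    have := hML v
    simp at this
    rw [← this] at hv; simp at hv
  have hbb : BddBelow (range fun v : Metric.sphere (0 : V2) 1 => ‖L (v : V2)‖) :=
    ⟨0, by rintro _ ⟨v, rfl⟩; exact norm_nonneg _⟩
  have hlow : ‖M‖⁻¹ ≤ minNorm L := by
    refine le_ciInf fun v => ?_
    have hv : ‖(v : V2)‖ = 1 := by simpa using v.2
    rw [inv_le_iff_one_le_mul₀' hM]
    have := M.le_opNorm (L v)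
    rwa [hML, hv] at this
  refine le_antisymm ?_ hlow
  have hm : 0 < minNorm L := (inv_pos.2 hM).trans_le hlow
  rw [le_inv_comm₀ hm hM]
  refine M.opNorm_le_bound (inv_nonneg.2 hm.le) fun w => ?_
  by_cases hw : M w = 0
  · rw [hw]; simp; positivity
  · have hn : 0 < ‖M w‖ := norm_pos_iff.2 hw
    have hs : ‖(‖M w‖)⁻¹ • M w‖ = 1 := by
      rw [norm_smul, norm_inv, norm_norm, inv_mul_cancel₀ hn.ne']
    have := ciInf_le hbb ⟨(‖M w‖)⁻¹ • M w, by rw [mem_sphere_zero_iff_norm]; exact hs⟩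
    have h3 : minNorm L ≤ ‖M w‖⁻¹ * ‖w‖ := by
      refine this.trans (le_of_eq ?_)
      simp only [map_smul, hLM, norm_smul, norm_inv, norm_norm]
    rw [inv_mul_eq_div, le_div_iff₀ hn] at h3
    rw [inv_mul_eq_div, le_div_iff₀ hm]
    linarith

lemma det_le (L : V2 →L[ℝ] V2) (v : V2) (hv : ‖v‖ = 1) :
    |LinearMap.det (L : V2 →ₗ[ℝ] V2)| ≤ ‖L v‖ * ‖L‖ := by
  set e0 : V2 := EuclideanSpace.single 0 1 with he0
  set e1 : V2 := EuclideanSpace.single 1 1 with he1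
  have hdet : LinearMap.det (L : V2 →ₗ[ℝ] V2) = L e0 0 * L e1 1 - L e1 0 * L e0 1 := by
    rw [← LinearMap.det_toMatrix (EuclideanSpace.basisFun (Fin 2) ℝ).toBasis, Matrix.det_fin_two]
    simp [LinearMap.toMatrix_apply, he0, he1]
  have hv2 : v 0 ^ 2 + v 1 ^ 2 = 1 := by
    have := EuclideanSpace.real_norm_sq_eq v
    rw [hv, Fin.sum_univ_two] at this
    linarith
  have hLv : ∀ u : V2, L u = u 0 • L e0 + u 1 • L e1 := by
    intro u
    rw [← map_smul, ← map_smul, ← map_add]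
    congr 1
    ext i
    fin_cases i <;> simp [he0, he1]
  set w : V2 := !₂[- v 1, v 0] with hw
  have hwn : ‖w‖ = 1 := by
    have h1 : ‖w‖ ^ 2 = 1 := by
      rw [EuclideanSpace.real_norm_sq_eq, Fin.sum_univ_two]
      simp [hw]
      linarith
    nlinarith [norm_nonneg w]
  have hLw : ‖L w‖ ≤ ‖L‖ := by
    have := L.le_opNorm w
    rwa [hwn, mul_one] at this
  have hd2 : LinearMap.det (L : V2 →ₗ[ℝ] V2) = L v 0 * L w 1 - L v 1 * L w 0 := by
    rw [hdet, hLv v, hLv w]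
    have e0 : w 0 = - v 1 := rfl
    have e1 : w 1 = v 0 := rfl
    simp only [PiLp.add_apply, PiLp.smul_apply, smul_eq_mul, e0, e1]
    linear_combination (-(L (EuclideanSpace.single 0 1) 0 * L (EuclideanSpace.single 1 1) 1 - L (EuclideanSpace.single 1 1) 0 * L (EuclideanSpace.single 0 1) 1)) * hv2
  refine le_trans ?_ (mul_le_mul_of_nonneg_left hLw (norm_nonneg _))
  rw [← abs_of_nonneg (mul_nonneg (norm_nonneg (L v)) (norm_nonneg (L w))), ← sq_le_sq, mul_pow,
    EuclideanSpace.real_norm_sq_eq, EuclideanSpace.real_norm_sq_eq, Fin.sum_univ_two,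
    Fin.sum_univ_two, hd2]
  nlinarith [sq_nonneg (L v 0 * L w 0 + L v 1 * L w 1)]

end Geometry

section Main

lemma norm_Dn_pos (f : TorusMap 2) (n : ℕ) (x : T2) : 0 < ‖f.Dn n x‖ := by
  rw [norm_pos_iff]
  intro h
  have := Dninv_mul f n x
  rw [h, mul_zero] at this
  exact zero_ne_one this

lemma norm_Dninv_pos (f : TorusMap 2) (n : ℕ) (x : T2) : 0 < ‖f.Dninv n x‖ := by
  rw [norm_pos_iff]
  intro h
  have := Dninv_mul f n x
  rw [h, zero_mul] at this
  exact zero_ne_one this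

lemma log_abs_bounds {A B k : ℝ} (hA : 0 < A) (hB : 0 < B) (hAB : 1 ≤ A * B)
    (hAk : A ≤ Real.exp k) (hBk : B ≤ Real.exp k) : |Real.log A| ≤ k := by
  have h1 : Real.log A ≤ k := (Real.log_le_iff_le_exp hA).2 hAk
  have h2 : Real.log B ≤ k := (Real.log_le_iff_le_exp hB).2 hBk
  have h3 := Real.log_nonneg hAB
  rw [Real.log_mul hA.ne' hB.ne'] at h3
  rw [abs_le]
  constructor <;> linarith

lemma one_le_norm_mul (f : TorusMap 2) (n : ℕ) (x : T2) :
    1 ≤ ‖f.Dninv n x‖ * ‖f.Dn n x‖ := by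
  have h := norm_mul_le (f.Dninv n x) (f.Dn n x)
  rw [Dninv_mul] at h
  simpa using h

lemma log_Dn_sub (f : TorusMap 2) (m n : ℕ) (x : T2) :
    Real.log ‖f.Dn (m + n) x‖ ≤ Real.log ‖f.Dn m x‖ + Real.log ‖f.Dn n (f.toFun^[m] x)‖ := by
  rw [← Real.log_mul (norm_Dn_pos _ _ _).ne' (norm_Dn_pos _ _ _).ne']
  refine Real.log_le_log (norm_Dn_pos _ _ _) ?_
  rw [Dn_add, mul_comm]
  exact norm_mul_le _ _

lemma log_Dninv_sub (f : TorusMap 2) (m n : ℕ) (x : T2) :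
    Real.log ‖f.Dninv (m + n) x‖ ≤
      Real.log ‖f.Dninv m x‖ + Real.log ‖f.Dninv n (f.toFun^[m] x)‖ := by
  rw [← Real.log_mul (norm_Dninv_pos _ _ _).ne' (norm_Dninv_pos _ _ _).ne']
  refine Real.log_le_log (norm_Dninv_pos _ _ _) ?_
  rw [Dninv_add]
  exact norm_mul_le _ _

lemma one_le_det (f : TorusMap 2) (hdet : 1 < ⨅ x : T2, |f.detD x|) (n : ℕ) :
    ∀ x, 1 ≤ |LinearMap.det (f.Dn n x : V2 →ₗ[ℝ] V2)| := by
  have h1 : ∀ x, 1 ≤ |f.detD x| := fun x =>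
    hdet.le.trans (ciInf_le ⟨0, by rintro _ ⟨y, rfl⟩; exact abs_nonneg _⟩ x)
  induction n with
  | zero =>
    intro x
    have : (f.Dn 0 x : V2 →ₗ[ℝ] V2) = LinearMap.id := rfl
    rw [this, LinearMap.det_id]; simp
  | succ n ih =>
    intro x
    have : (f.Dn (n + 1) x : V2 →ₗ[ℝ] V2) =
      (f.Dn n (f.toFun x) : V2 →ₗ[ℝ] V2).comp (f.D x : V2 →ₗ[ℝ] V2) := rfl
    rw [this, LinearMap.det_comp, abs_mul]
    exact one_le_mul_of_one_le_of_one_le (ih _) (h1 x)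

lemma minNorm_Dn (f : TorusMap 2) (n : ℕ) (x : T2) :
    minNorm (f.Dn n x) = ‖f.Dninv n x‖⁻¹ :=
  minNorm_eq (mul_Dninv f n x) (Dninv_mul f n x)

lemma norm_inv_le (f : TorusMap 2) (hdet : 1 < ⨅ x : T2, |f.detD x|) (n : ℕ) (x : T2) :
    ‖f.Dninv n x‖ ≤ ‖f.Dn n x‖ := by
  have := sphere_nonempty
  have hp := norm_Dn_pos f n x
  have h1 : ‖f.Dn n x‖⁻¹ ≤ minNorm (f.Dn n x) := by
    refine le_ciInf fun v => ?_
    have h2 := (one_le_det f hdet n x).trans (det_le (f.Dn n x) v (by simp))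
    rwa [inv_le_iff_one_le_mul₀ hp]
  rw [minNorm_Dn] at h1
  exact (inv_le_inv₀ hp (norm_Dninv_pos f n x)).1 h1

lemma unifInf_event (f : TorusMap 2) {b : ℝ} (hb : b < f.C) (hC : 0 < f.C) :
    ∀ᶠ n : ℕ in atTop, b ≤ f.unifInf n / n := by
  unfold TorusMap.C at hb hC
  rw [liminf_eq] at hb hC
  have hne : {a | ∀ᶠ n : ℕ in atTop, a ≤ f.unifInf n / n}.Nonempty := by
    by_contra h
    rw [not_nonempty_iff_eq_empty] at h
    rw [h, Real.sSup_empty] at hC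
    exact lt_irrefl _ hC
  obtain ⟨a, ha, hba⟩ := exists_lt_of_lt_csSup hne hb
  exact Eventually.mono ha fun n hn => hba.le.trans hn

lemma le_I_of (f : TorusMap 2) {b : ℝ} (hb : 0 < b) {n : ℕ} (hn : 0 < n)
    (h : b ≤ f.unifInf n / n) (x : T2) (v : V2) (hv : ‖v‖ = 1) : n * b ≤ f.I x v n := by
  have hn' : (0:ℝ) < n := by exact_mod_cast hn
  rw [le_div_iff₀ hn', mul_comm] at h
  by_cases hbd : BddBelow (range fun xv : T2 × Metric.sphere (0 : V2) 1 => f.I xv.1 (xv.2 : V2) n)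
  · exact h.trans (ciInf_le hbd (x, ⟨v, by simpa using hv⟩))
  · have h0 : f.unifInf n = 0 := Real.iInf_of_not_bddBelow hbd
    rw [h0] at h
    nlinarith

lemma lower_rate_ge (f : TorusMap 2) (hdeg : 2 ≤ f.deg) (hC : 0 < f.C)
    (μ : Measure T2) [IsProbabilityMeasure μ] (hT : MeasurePreserving f.toFun μ μ)
    (heq : f.Equidistributed μ) {K : ℝ} (hK : 0 ≤ K)
    (hKb : ∀ (n : ℕ) (x : T2), ‖f.Dn n x‖ ≤ Real.exp (n * K) ∧ ‖f.Dninv n x‖ ≤ Real.exp (n * K))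
    (hm : ∀ n, Measurable fun x => Real.log ‖f.Dninv n x‖)
    (hbd : ∀ n x, |Real.log ‖f.Dninv n x‖| ≤ n * K) :
    ∀ᵐ x ∂μ, f.C ≤ lowRate (fun n x => Real.log ‖f.Dninv n x‖) x := by
  set c : ℕ → T2 → ℝ := fun n x => Real.log ‖f.Dninv n x‖ with hc
  have hsub := log_Dninv_sub f
  have hconv := kingman hT hK hm hbd hsub
  have hinv := lowRate_inv hT hK hm hbd hsub
  have hgm : Measurable (lowRate c) := lowRate_meas hm
  have hgK := lowRate_abs hK hbd
  obtain ⟨m, P, hPm, hP⟩ := exists_label f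
  obtain ⟨v, hv⟩ := exists_unit_vec
  have key : ∀ t : ℝ, t < f.C → ∀ᵐ x ∂μ, t ≤ lowRate c x := by
    intro t ht
    obtain ⟨b, hb1, hb2⟩ := exists_between (max_lt ht hC)
    have hbt : t < b := (le_max_left _ _).trans_lt hb1
    have hb0 : 0 < b := (le_max_right _ _).trans_lt hb1
    set B : Set T2 := {x | lowRate c x < t} with hB
    have hBm : MeasurableSet B := measurableSet_lt hgm measurable_const
    have h1 : ∀ᶠ n : ℕ in atTop, b * μ.real B ≤ ∫ x in B, c n x / n ∂μ := by
      filter_upwards [unifInf_event f hb2 hC, eventually_gt_atTop 0] with n hn hn0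
      have hn0' : (0:ℝ) < n := by exact_mod_cast hn0
      have hvpos : ∀ x, 0 < ‖f.Dninv n x v‖ ∧ ‖f.Dninv n x v‖ ≤ ‖f.Dninv n x‖ ∧
          1 ≤ ‖f.Dninv n x v‖ * ‖f.Dn n x‖ := by
        intro x
        have e1 : f.Dn n x (f.Dninv n x v) = v := by
          have := congrArg (fun N : V2 →L[ℝ] V2 => N v) (mul_Dninv f n x); exact this
        have e2 := (f.Dn n x).le_opNorm (f.Dninv n x v)
        rw [e1, hv, mul_comm] at e2
        refine ⟨?_, ?_, e2⟩
        · by_contra h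
          have : ‖f.Dninv n x v‖ = 0 := le_antisymm (not_lt.1 h) (norm_nonneg _)
          rw [this] at e2
          norm_num at e2
        · have := (f.Dninv n x).le_opNorm v
          rwa [hv, mul_one] at this
      have hφm : Measurable fun x => Real.log ‖f.Dninv n x v‖ :=
        Real.measurable_log.comp
          (((Dninv_cont f n).clm_apply continuous_const).norm.measurable)
      have hφK : ∀ x, |Real.log ‖f.Dninv n x v‖| ≤ n * K := fun x =>
        log_abs_bounds (hvpos x).1 (norm_Dn_pos f n x) (hvpos x).2.2
          ((hvpos x).2.1.trans (hKb n x).2) (hKb n x).1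
      have h2 := transfer_iter (μ := μ) (toFun_cont f).measurable (D := f.deg) (by omega)
        (fun s hs hi => heq s hs hi) P hPm hP n hφm (mul_nonneg hn0'.le hK) hφK
        (b := n * b) (fun x => le_I_of f hb0 hn0 hn x v hv) hBm
      have h3 : (f.toFun^[n] ⁻¹' B : Set T2) =ᵐ[μ] B := by
        filter_upwards [hinv] with x hx
        have hx' := hx n
        apply propext
        show lowRate c (f.toFun^[n] x) < t ↔ lowRate c x < t
        rw [hx']
      rw [setIntegral_congr_set h3] at h2
      have h4 : ∫ x in B, Real.log ‖f.Dninv n x v‖ ∂μ ≤ ∫ x in B, c n x ∂μ := by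
        refine integral_mono (integrable_bdd hφm hφK).integrableOn
          (integrable_bdd (hm n) (hbd n)).integrableOn fun x => ?_
        exact Real.log_le_log (hvpos x).1 (hvpos x).2.1
      rw [integral_div, le_div_iff₀ hn0']
      linarith
    have h2 : Tendsto (fun n : ℕ => ∫ x in B, c n x / n ∂μ) atTop
        (𝓝 (∫ x in B, lowRate c x ∂μ)) := by
      refine tendsto_integral_of_dominated_convergence (fun _ => K)
        (fun n => ((hm n).div_const _).aestronglyMeasurable) (integrable_const _) ?_ ?_
      · intro n
        exact Eventually.of_forall fun x => div_abs_le hK (fun n => hbd n x) n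
      · exact ae_restrict_of_ae hconv
    have h3 : b * μ.real B ≤ ∫ x in B, lowRate c x ∂μ := ge_of_tendsto h2 h1
    have h4 : ∫ x in B, lowRate c x ∂μ ≤ t * μ.real B := by
      have : t * μ.real B = ∫ x in B, t ∂μ := by simp [mul_comm]
      rw [this]
      refine setIntegral_mono_on (integrable_bdd hgm hgK).integrableOn
        (integrable_const _) hBm fun x hx => ?_
      exact le_of_lt hx
    have h5 : μ.real B = 0 := by
      have := measureReal_nonneg (μ := μ) (s := B)
      nlinarith
    rw [measureReal_eq_zero_iff] at h5
    rw [ae_iff]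
    simpa only [not_le] using h5
  obtain ⟨u, -, hu, hulim⟩ := exists_seq_strictMono_tendsto f.C
  have h := ae_all_iff.2 fun k => key (u k) (hu k)
  filter_upwards [h] with x hx
  exact le_of_tendsto' hulim hx

end Main

/-- Let `f` be a `C²` local diffeomorphism of `𝕋²` of degree `d ≥ 2` with
`C(f) > 0` and `inf_x |det Df_x| > 1`. Then every equidistributed `f`-invariant Borel
probability measure `μ` is `C(f)`-hyperbolic: for `μ`-a.e. `x` the Lyapunov exponents
`χ⁺(x) = lim_n (1/n) log‖Dfⁿ_x‖` and `χ⁻(x) = lim_n (1/n) log m(Dfⁿ_x)` exist and satisfy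
`χ⁻(x) ≤ -C(f) < C(f) ≤ χ⁺(x)`. -/
theorem equidistributed_measures_are_hyperbolic (f : TorusMap 2) (hdeg : 2 ≤ f.deg)
    (hC : 0 < f.C) (hdet : 1 < ⨅ x : T2, |f.detD x|)
    (μ : Measure T2) (hprob : IsProbabilityMeasure μ) (hinv : f.Invariant μ)
    (heq : f.Equidistributed μ) :
    ∀ᵐ x ∂μ, ∃ χp χm : ℝ,
      Tendsto (fun n : ℕ => Real.log ‖f.Dn n x‖ / n) atTop (𝓝 χp) ∧
      Tendsto (fun n : ℕ => Real.log (minNorm (f.Dn n x)) / n) atTop (𝓝 χm) ∧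
      χm ≤ -f.C ∧ f.C ≤ χp := by
  obtain ⟨K, hK, hKb⟩ := exists_K f
  have hT : MeasurePreserving f.toFun μ μ := by
    refine ⟨(toFun_cont f).measurable, ?_⟩
    ext s hs
    rw [Measure.map_apply (toFun_cont f).measurable hs]
    exact hinv s hs
  have hm1 : ∀ n, Measurable fun x => Real.log ‖f.Dn n x‖ := fun n =>
    Real.measurable_log.comp (Dn_cont f n).norm.measurable
  have hm2 : ∀ n, Measurable fun x => Real.log ‖f.Dninv n x‖ := fun n =>
    Real.measurable_log.comp (Dninv_cont f n).norm.measurable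
  have hb1 : ∀ n x, |Real.log ‖f.Dn n x‖| ≤ n * K := fun n x =>
    log_abs_bounds (norm_Dn_pos f n x) (norm_Dninv_pos f n x)
      (by rw [mul_comm]; exact one_le_norm_mul f n x) (hKb n x).1 (hKb n x).2
  have hb2 : ∀ n x, |Real.log ‖f.Dninv n x‖| ≤ n * K := fun n x =>
    log_abs_bounds (norm_Dninv_pos f n x) (norm_Dn_pos f n x)
      (one_le_norm_mul f n x) (hKb n x).2 (hKb n x).1
  filter_upwards [kingman hT hK hm1 hb1 (log_Dn_sub f), kingman hT hK hm2 hb2 (log_Dninv_sub f),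
    lower_rate_ge f hdeg hC μ hT heq hK hKb hm2 hb2] with x h1 h2 h3
  refine ⟨_, _, h1, ?_, neg_le_neg h3, h3.trans ?_⟩
  · have h4 := h2.neg
    refine h4.congr fun n => ?_
    rw [minNorm_Dn, Real.log_inv, neg_div]
  · refine le_of_tendsto_of_tendsto' h2 h1 fun n => ?_
    refine div_le_div_of_nonneg_right ?_ (Nat.cast_nonneg n)
    exact Real.log_le_log (norm_Dninv_pos f n x) (norm_inv_le f hdet n x)

end
end
end
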